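/- Let 1 ≤ p < q < ∞ and for each n let X^{(n)} ~ ν_p^n. Then the sequence (n^{1/p−1/q} ‖X^{(n)}‖_q)_{n} satisfies a large deviation principle with speed n^{p/q} and good rate function I(x) = (1/p)(x^q − m_{p,q}^q)^{p/q} for x ≥ m_{p,q} and I(x) = +∞ otherwise; that is, for every Borel set A ⊆ ℝ, −inf_{x ∈ int(A)} I(x) ≤ liminf_{n→∞} n^{−p/q} log ℙ(n^{1/p−1/q} ‖X^{(n)}‖_q ∈ A) ≤ limsup_{n→∞} n^{−p/q} log ℙ(n^{1/p−1/q} ‖X^{(n)}‖_q ∈ A) ≤ −inf_{x ∈ cl(A)} I(x). -/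

import Mathlib

open MeasureTheory Set Filter
open scoped ENNReal NNReal Topology

/-- The `q`-norm on `ℝ^n`. -/
noncomputable def pnorm {n : ℕ} (q : ℝ) (x : Fin n → ℝ) : ℝ :=
  (∑ i, |x i| ^ q) ^ (1 / q)

/-- The unit ball `𝔹_p^n`. -/
def pBall (n : ℕ) (p : ℝ) : Set (Fin n → ℝ) := {x | pnorm p x ≤ 1}

/-- The uniform probability measure `ν_p^n` on `𝔹_p^n`. -/
noncomputable def nuMeasure (n : ℕ) (p : ℝ) : Measure (Fin n → ℝ) :=
  (volume (pBall n p))⁻¹ • volume.restrict (pBall n p)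

/-- `M_p(q)`. -/
noncomputable def Mp (p q : ℝ) : ℝ :=
  p ^ (q / p) / (q + 1) * (Real.Gamma (1 + (q + 1) / p) / Real.Gamma (1 + 1 / p))

/-- `m_{p,q} = M_p(q)^{1/q}`. -/
noncomputable def mpq (p q : ℝ) : ℝ := Mp p q ^ (1 / q)

/-- A sequence of distributions `μ_n` on `ℝ` satisfies a large deviation principle with
speed `s(n)` and good rate function `I` if `I` has compact sublevel sets and for every
Borel set `A`,
`−inf_{int A} I ≤ liminf s(n)⁻¹ log μ_n(A) ≤ limsup s(n)⁻¹ log μ_n(A) ≤ −inf_{cl A} I`. -/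
def IsLDP (μ : ℕ → Measure ℝ) (s : ℕ → ℝ) (I : ℝ → ℝ≥0∞) : Prop :=
  (∀ c : ℝ≥0, IsCompact {x : ℝ | I x ≤ (c : ℝ≥0∞)}) ∧
  ∀ A : Set ℝ, MeasurableSet A →
    (-(((⨅ x ∈ interior A, I x) : ℝ≥0∞) : EReal) ≤
        liminf (fun n => (((s n)⁻¹ : ℝ) : EReal) * ENNReal.log (μ n A)) atTop ∧
      limsup (fun n => (((s n)⁻¹ : ℝ) : EReal) * ENNReal.log (μ n A)) atTop ≤
        -(((⨅ x ∈ closure A, I x) : ℝ≥0∞) : EReal))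

section ProductMeasure

theorem lintegral_pi_prod {n : ℕ} (μ : Measure ℝ) [SigmaFinite μ] (f : Fin n → ℝ → ℝ≥0∞)
    (hf : ∀ i, Measurable (f i)) :
    ∫⁻ y, ∏ i, f i (y i) ∂(Measure.pi fun _ : Fin n => μ) = ∏ i, ∫⁻ x, f i x ∂μ := by
  induction n with
  | zero => simp
  | succ n ih =>
    have h := (measurePreserving_piFinSuccAbove (fun _ : Fin (n + 1) => μ) 0)
    rw [← h.symm.lintegral_comp_emb (MeasurableEquiv.measurableEmbedding _)]
    simp_rw [MeasurableEquiv.piFinSuccAbove_symm_apply, Fin.insertNthEquiv, Fin.prod_univ_succ]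
    simp only [Fin.insertNth_zero, Equiv.coe_fn_mk, Fin.cons_zero, Fin.cons_succ]
    have hm : Measurable fun y : Fin n → ℝ => ∏ i : Fin n, f i.succ (y i) :=
      Finset.measurable_prod _ fun i _ => (hf i.succ).comp (measurable_pi_apply i)
    exact (lintegral_prod_mul (hf 0).aemeasurable hm.aemeasurable).trans
      (by rw [ih _ fun i => hf i.succ])

theorem pi_withDensity {n : ℕ} (μ : Measure ℝ) [SigmaFinite μ] (f : ℝ → ℝ≥0∞)
    (hf : Measurable f) [SigmaFinite (μ.withDensity f)] :
    Measure.pi (fun _ : Fin n => μ.withDensity f) =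
      (Measure.pi fun _ : Fin n => μ).withDensity fun y => ∏ i, f (y i) := by
  refine Measure.pi_eq fun s hs => ?_
  rw [withDensity_apply _ (MeasurableSet.univ_pi hs),
    ← lintegral_indicator (MeasurableSet.univ_pi hs)]
  simp_rw [withDensity_apply _ (hs _), ← lintegral_indicator (hs _)]
  rw [← lintegral_pi_prod μ (fun i => (s i).indicator f) fun i => hf.indicator (hs i)]
  refine lintegral_congr fun y => ?_
  by_cases hy : y ∈ univ.pi s
  · rw [indicator_of_mem hy]
    exact Finset.prod_congr rfl fun i _ => (indicator_of_mem (hy i trivial) f).symm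
  · rw [indicator_of_notMem hy]
    simp only [mem_univ_pi, not_forall] at hy
    obtain ⟨i, hi⟩ := hy
    exact (Finset.prod_eq_zero (Finset.mem_univ i) (indicator_of_notMem hi f)).symm

/-- Exponential Markov inequality for sums of independent copies. -/
theorem pi_sum_ge_le {n : ℕ} (μ : Measure ℝ) [IsProbabilityMeasure μ] (φ : ℝ → ℝ)
    (hφ : Measurable φ) (b : ℝ) :
    (Measure.pi fun _ : Fin n => μ) {y | b ≤ ∑ i, φ (y i)} ≤
      ENNReal.ofReal (Real.exp (-b)) * (∫⁻ x, ENNReal.ofReal (Real.exp (φ x)) ∂μ) ^ n := by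
  have hm : Measurable fun x => ENNReal.ofReal (Real.exp (φ x)) := by fun_prop
  have h := lintegral_pi_prod (n := n) μ (fun _ x => ENNReal.ofReal (Real.exp (φ x))) fun _ => hm
  simp only [Finset.prod_const, Finset.card_univ, Fintype.card_fin] at h
  have hm' : Measurable fun y : Fin n → ℝ => ∏ i, ENNReal.ofReal (Real.exp (φ (y i))) := by
    fun_prop
  rw [← h, ← lintegral_const_mul _ hm']
  have hset : MeasurableSet {y : Fin n → ℝ | b ≤ ∑ i, φ (y i)} :=
    measurableSet_le measurable_const (by fun_prop)
  rw [← lintegral_indicator_one hset]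
  refine lintegral_mono fun y => ?_
  by_cases hy : b ≤ ∑ i, φ (y i)
  · rw [indicator_of_mem (by exact hy), Pi.one_apply,
      ← ENNReal.ofReal_prod_of_nonneg fun i _ => (Real.exp_pos _).le, ← Real.exp_sum,
      ← ENNReal.ofReal_mul (Real.exp_pos _).le, ← Real.exp_add, ENNReal.one_le_ofReal]
    exact Real.one_le_exp (by linarith)
  · rw [indicator_of_notMem (by exact hy)]
    exact zero_le

end ProductMeasure

section PGaussian

/-- The density of the `p`-Gaussian distribution. -/
noncomputable def pGaussianPDF (p y : ℝ) : ℝ :=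
  (2 * (p ^ (1 / p) * Real.Gamma (1 + 1 / p)))⁻¹ * Real.exp (-(1 / p) * |y| ^ p)

/-- The `p`-Gaussian distribution. -/
noncomputable def pGaussian (p : ℝ) : Measure ℝ :=
  volume.withDensity fun y => ENNReal.ofReal (pGaussianPDF p y)

variable {p : ℝ}

theorem integrable_comp_abs_of_integrableOn {f : ℝ → ℝ} (hf : IntegrableOn f (Ioi 0)) :
    Integrable fun x => f |x| := by
  have h1 : IntegrableOn (fun x => f |x|) (Ioi 0) :=
    hf.congr_fun (fun x hx => by rw [abs_of_pos (by exact hx)]) measurableSet_Ioi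
  have h2 : IntegrableOn (fun x => f |x|) (Iic 0) := by
    rw [← Measure.map_neg_eq_self (volume : Measure ℝ)]
    have m : MeasurableEmbedding fun x : ℝ => -x :=
      (Homeomorph.neg ℝ).isClosedEmbedding.measurableEmbedding
    rw [m.integrableOn_map_iff]
    simp_rw [Function.comp_def, abs_neg, neg_preimage, neg_Iic, neg_zero]
    exact (integrableOn_Ici_iff_integrableOn_Ioi (by simp)).2 h1
  rw [← integrableOn_univ, ← Iic_union_Ioi (a := (0 : ℝ))]
  exact h2.union h1

theorem integrable_abs_rpow_mul_exp (hp : 0 < p) {s b : ℝ} (hs : 0 ≤ s) (hb : 0 < b) :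
    Integrable fun y : ℝ => |y| ^ s * Real.exp (-b * |y| ^ p) :=
  integrable_comp_abs_of_integrableOn
    (integrableOn_rpow_mul_exp_neg_mul_rpow (by linarith) hp hb)

theorem integral_abs_rpow_mul_exp (hp : 0 < p) {s : ℝ} (hs : 0 ≤ s) :
    ∫ y : ℝ, |y| ^ s * Real.exp (-(1 / p) * |y| ^ p) =
      2 * (p ^ (1 / p) * Real.Gamma (1 + 1 / p)) * Mp p s := by
  rw [integral_comp_abs (f := fun y => y ^ s * Real.exp (-(1 / p) * y ^ p)),
    integral_rpow_mul_exp_neg_mul_rpow hp (by linarith) (by positivity), Mp,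
    add_comm 1 ((s + 1) / p), Real.Gamma_add_one (by positivity)]
  have h1 : (1 / p : ℝ) ^ (-(s + 1) / p) = p ^ (1 / p) * p ^ (s / p) := by
    rw [one_div, Real.inv_rpow hp.le, ← Real.rpow_neg hp.le, ← Real.rpow_add hp]
    congr 1; ring
  have h2 : Real.Gamma (1 + 1 / p) ≠ 0 := (Real.Gamma_pos_of_pos (by positivity)).ne'
  rw [h1]
  field_simp

theorem pGaussianPDF_const_pos (hp : 0 < p) :
    0 < 2 * (p ^ (1 / p) * Real.Gamma (1 + 1 / p)) := by
  have := Real.Gamma_pos_of_pos (show 0 < 1 + 1 / p by positivity)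
  positivity

theorem pGaussianPDF_pos (hp : 0 < p) (y : ℝ) : 0 < pGaussianPDF p y :=
  mul_pos (inv_pos.2 (pGaussianPDF_const_pos hp)) (Real.exp_pos _)

theorem measurable_pGaussianPDF : Measurable (pGaussianPDF p) := by
  unfold pGaussianPDF
  fun_prop

theorem Mp_zero (hp : 0 < p) : Mp p 0 = 1 := by
  have h2 : Real.Gamma (1 + 1 / p) ≠ 0 := (Real.Gamma_pos_of_pos (by positivity)).ne'
  simp only [Mp, zero_div, Real.rpow_zero, zero_add]
  field_simp

theorem Mp_self (hp : 0 < p) : Mp p p = 1 := by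
  have h2 : Real.Gamma (1 + 1 / p) ≠ 0 := (Real.Gamma_pos_of_pos (by positivity)).ne'
  have h3 : 1 + (p + 1) / p = (1 + 1 / p) + 1 := by field_simp; ring
  rw [Mp, h3, Real.Gamma_add_one (by positivity), div_self hp.ne', Real.rpow_one]
  field_simp

theorem Mp_pos (hp : 0 < p) {s : ℝ} (hs : 0 ≤ s) : 0 < Mp p s := by
  have h2 := Real.Gamma_pos_of_pos (show 0 < 1 + 1 / p by positivity)
  have h3 := Real.Gamma_pos_of_pos (show 0 < 1 + (s + 1) / p by positivity)
  unfold Mp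
  positivity

theorem isProbabilityMeasure_pGaussian (hp : 0 < p) : IsProbabilityMeasure (pGaussian p) := by
  refine ⟨?_⟩
  rw [pGaussian, withDensity_apply _ MeasurableSet.univ, setLIntegral_univ]
  have hi := (integrable_abs_rpow_mul_exp hp (b := 1 / p) le_rfl (by positivity)).const_mul
    (2 * (p ^ (1 / p) * Real.Gamma (1 + 1 / p)))⁻¹
  have he := integral_abs_rpow_mul_exp hp (s := 0) le_rfl
  simp only [Real.rpow_zero, one_mul, Mp_zero hp, mul_one] at hi he
  unfold pGaussianPDF
  rw [← ofReal_integral_eq_lintegral_ofReal hi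
    (Eventually.of_forall fun y => (pGaussianPDF_pos hp y).le), integral_const_mul, he,
    inv_mul_cancel₀ (pGaussianPDF_const_pos hp).ne', ENNReal.ofReal_one]

theorem integrable_pGaussian_iff (hp : 0 < p) (f : ℝ → ℝ) :
    Integrable f (pGaussian p) ↔ Integrable fun y => f y * Real.exp (-(1 / p) * |y| ^ p) := by
  rw [pGaussian, integrable_withDensity_iff (by exact measurable_pGaussianPDF.ennreal_ofReal)
    (Eventually.of_forall fun _ => ENNReal.ofReal_lt_top)]
  simp_rw [ENNReal.toReal_ofReal (pGaussianPDF_pos hp _).le, pGaussianPDF]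
  rw [← integrable_const_mul_iff
    (IsUnit.mk0 _ (inv_ne_zero (pGaussianPDF_const_pos hp).ne')) 
      (fun y => f y * Real.exp (-(1 / p) * |y| ^ p))]
  simp only [mul_left_comm (f _)]

theorem integrable_pGaussian_rpow_mul_exp (hp : 0 < p) {s κ : ℝ} (hs : 0 ≤ s) (hκ : κ < 1) :
    Integrable (fun y : ℝ => |y| ^ s * Real.exp (κ / p * |y| ^ p)) (pGaussian p) := by
  rw [integrable_pGaussian_iff hp]
  convert! integrable_abs_rpow_mul_exp hp hs (b := (1 - κ) / p)
    (div_pos (by linarith) hp) using 2 with y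
  rw [mul_assoc, ← Real.exp_add]
  congr 2
  ring

theorem integrable_pGaussian_rpow (hp : 0 < p) {s : ℝ} (hs : 0 ≤ s) :
    Integrable (fun y : ℝ => |y| ^ s) (pGaussian p) := by
  simpa using integrable_pGaussian_rpow_mul_exp hp hs (κ := 0) one_pos

theorem integral_pGaussian_rpow (hp : 0 < p) {s : ℝ} (hs : 0 ≤ s) :
    ∫ y, |y| ^ s ∂(pGaussian p) = Mp p s := by
  rw [pGaussian, integral_withDensity_eq_integral_toReal_smul
    (by exact measurable_pGaussianPDF.ennreal_ofReal)
    (Eventually.of_forall fun _ => ENNReal.ofReal_lt_top)]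
  simp_rw [ENNReal.toReal_ofReal (pGaussianPDF_pos hp _).le, pGaussianPDF, smul_eq_mul,
    mul_assoc _ (Real.exp _)]
  rw [integral_const_mul]
  simp_rw [mul_comm (Real.exp _)]
  rw [integral_abs_rpow_mul_exp hp hs,
    inv_mul_cancel_left₀ (pGaussianPDF_const_pos hp).ne']

theorem memLp_pGaussian_rpow (hp : 0 < p) {s : ℝ} (hs : 0 ≤ s) :
    MemLp (fun y : ℝ => |y| ^ s) 2 (pGaussian p) := by
  rw [memLp_two_iff_integrable_sq (by fun_prop)]
  convert! integrable_pGaussian_rpow hp (s := s * 2) (by positivity) using 2 with y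
  rw [Real.rpow_mul (abs_nonneg _)]
  norm_cast

end PGaussian

section Comparison

variable {p : ℝ} {n : ℕ}

theorem pBall_eq (hp : 0 < p) : pBall n p = {x | ∑ i, |x i| ^ p ≤ 1} := by
  ext x
  simp only [pBall, pnorm, mem_ofPred_eq]
  rw [← Real.rpow_le_rpow_iff (z := 1 / p) (Finset.sum_nonneg fun i _ => by positivity)
    zero_le_one (by positivity), Real.one_rpow]

theorem sum_abs_smul_rpow {r : ℝ} (hr : 0 ≤ r) (s : ℝ) (x : Fin n → ℝ) :
    ∑ i, |(r • x) i| ^ s = r ^ s * ∑ i, |x i| ^ s := by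
  rw [Finset.mul_sum]
  refine Finset.sum_congr rfl fun i _ => ?_
  rw [Pi.smul_apply, smul_eq_mul, abs_mul, abs_of_nonneg hr, Real.mul_rpow hr (abs_nonneg _)]

theorem pi_pGaussian_apply (hp : 0 < p) {T : Set (Fin n → ℝ)} (hT : MeasurableSet T) :
    (Measure.pi fun _ : Fin n => pGaussian p) T =
      ENNReal.ofReal ((2 * (p ^ (1 / p) * Real.Gamma (1 + 1 / p)))⁻¹ ^ n) *
        ∫⁻ y in T, ENNReal.ofReal (Real.exp (-(1 / p) * ∑ i, |y i| ^ p)) := by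
  have := isProbabilityMeasure_pGaussian hp
  unfold pGaussian at *
  rw [pi_withDensity volume _ measurable_pGaussianPDF.ennreal_ofReal, withDensity_apply _ hT,
    ← lintegral_const_mul _ (by fun_prop)]
  refine lintegral_congr fun y => ?_
  rw [← ENNReal.ofReal_prod_of_nonneg fun i _ => (pGaussianPDF_pos hp _).le,
    ← ENNReal.ofReal_mul (pow_nonneg (inv_pos.2 (pGaussianPDF_const_pos hp)).le _)]
  congr 1
  simp only [pGaussianPDF]
  rw [Finset.prod_mul_distrib, Finset.prod_const, Finset.card_univ, Fintype.card_fin,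
    ← Real.exp_sum, Finset.mul_sum]

/-- The total mass of the radial part of the measure with density `exp (-‖y‖_p ^ p / p)`. -/
noncomputable def radialMass (n : ℕ) (p : ℝ) : ℝ≥0∞ :=
  ∫⁻ t in Ioo (0 : ℝ) 1, ENNReal.ofReal ((-(p * Real.log t)) ^ (n / p))

theorem volume_cone_inter_le (hp : 0 < p) {D : Set (Fin n → ℝ)}
    (hD : ∀ r : ℝ, 0 < r → ∀ y, r • y ∈ D ↔ y ∈ D) {r : ℝ} (hr : 0 < r) :
    volume (D ∩ {y | ∑ i, |y i| ^ p ≤ r}) =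
      ENNReal.ofReal (r ^ (n / p)) * volume (D ∩ pBall n p) := by
  have hs : 0 < r ^ (-(1 / p)) := Real.rpow_pos_of_pos hr _
  have : D ∩ {y | ∑ i, |y i| ^ p ≤ r} = (r ^ (-(1 / p)) • ·) ⁻¹' (D ∩ pBall n p) := by
    ext y
    rw [pBall_eq hp]
    simp only [mem_inter_iff, mem_ofPred_eq, mem_preimage, hD _ hs, sum_abs_smul_rpow hs.le]
    rw [← Real.rpow_mul hr.le, neg_mul, one_div_mul_cancel hp.ne', Real.rpow_neg_one,
      inv_mul_le_one₀ hr]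
  rw [this, Measure.addHaar_preimage_smul _ hs.ne', Module.finrank_fin_fun]
  congr 2
  rw [abs_of_pos (by positivity), ← Real.rpow_natCast, ← Real.rpow_mul hr.le,
    ← Real.rpow_neg hr.le]
  congr 1
  ring

theorem lintegral_cone (hp : 0 < p) {D : Set (Fin n → ℝ)}
    (hD : ∀ r : ℝ, 0 < r → ∀ y, r • y ∈ D ↔ y ∈ D) :
    ∫⁻ y in D, ENNReal.ofReal (Real.exp (-(1 / p) * ∑ i, |y i| ^ p)) =
      radialMass n p * volume (D ∩ pBall n p) := by
  rw [lintegral_eq_lintegral_meas_le _ (Eventually.of_forall fun y => (Real.exp_pos _).le)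
    (by exact Measurable.aemeasurable (by fun_prop)), ← Ioc_union_Ioi_eq_Ioi (zero_le_one' ℝ),
    lintegral_union measurableSet_Ioi (by
      rw [Set.disjoint_left]; rintro t ⟨_, h1⟩ h2; exact absurd h2 (not_lt.2 h1)),
    ← restrict_Ioo_eq_restrict_Ioc]
  have h0 : ∀ t : ℝ, MeasurableSet
      {y : Fin n → ℝ | t ≤ Real.exp (-(1 / p) * ∑ i, |y i| ^ p)} := fun t =>
    measurableSet_le measurable_const (by fun_prop)
  have h2 : ∫⁻ t in Ioi (1 : ℝ), (volume.restrict D)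
      {y : Fin n → ℝ | t ≤ Real.exp (-(1 / p) * ∑ i, |y i| ^ p)} = 0 := by
    rw [setLIntegral_congr_fun (g := fun _ => 0) measurableSet_Ioi, lintegral_zero]
    intro t ht
    have : {y : Fin n → ℝ | t ≤ Real.exp (-(1 / p) * ∑ i, |y i| ^ p)} = ∅ := by
      refine eq_empty_of_forall_notMem fun y hy => ?_
      have h3 : Real.exp (-(1 / p) * ∑ i, |y i| ^ p) ≤ 1 := by
        rw [Real.exp_le_one_iff, neg_mul, neg_nonpos]
        have : 0 ≤ ∑ i, |y i| ^ p := Finset.sum_nonneg fun i _ => by positivity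
        positivity
      exact absurd (lt_of_lt_of_le ht hy) (not_lt.2 h3)
    simp only [this, measure_empty]
  rw [h2, add_zero, radialMass, ← lintegral_mul_const _ (by fun_prop)]
  refine setLIntegral_congr_fun measurableSet_Ioo fun t ht => ?_
  have hlog : Real.log t < 0 := Real.log_neg ht.1 ht.2
  rw [Measure.restrict_apply (h0 t), inter_comm,
    ← volume_cone_inter_le hp hD (r := -(p * Real.log t)) (by nlinarith)]
  congr 2
  ext y
  simp only [mem_ofPred_eq]
  rw [← Real.log_le_iff_le_exp ht.1, neg_mul, le_neg, one_div, inv_mul_le_iff₀ hp]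
  constructor <;> intro h <;> linarith

theorem volume_pBall_inv (hp : 0 < p) :
    (volume (pBall n p))⁻¹ =
      ENNReal.ofReal ((2 * (p ^ (1 / p) * Real.Gamma (1 + 1 / p)))⁻¹ ^ n) * radialMass n p := by
  have := isProbabilityMeasure_pGaussian hp
  have h := pi_pGaussian_apply (n := n) hp MeasurableSet.univ
  rw [measure_univ, lintegral_cone hp (D := univ) (by simp), univ_inter, ← mul_assoc] at h
  exact (ENNReal.eq_inv_of_mul_eq_one_left h.symm).symm

theorem nuMeasure_apply {S : Set (Fin n → ℝ)} (hS : MeasurableSet S) :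
    nuMeasure n p S = (volume (pBall n p))⁻¹ * volume (S ∩ pBall n p) := by
  rw [nuMeasure, Measure.smul_apply, Measure.restrict_apply hS, smul_eq_mul]

theorem nuMeasure_le_one (S : Set (Fin n → ℝ)) : nuMeasure n p S ≤ 1 := by
  refine (measure_mono (subset_univ S)).trans ?_
  rw [nuMeasure_apply MeasurableSet.univ, univ_inter]
  exact ENNReal.inv_mul_le_one _

/-- On cones, the uniform distribution on the ball agrees with the `p`-Gaussian product. -/
theorem nuMeasure_cone (hp : 0 < p) {D : Set (Fin n → ℝ)} (hDm : MeasurableSet D)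
    (hD : ∀ r : ℝ, 0 < r → ∀ y, r • y ∈ D ↔ y ∈ D) :
    nuMeasure n p D = (Measure.pi fun _ : Fin n => pGaussian p) D := by
  rw [nuMeasure_apply hDm, pi_pGaussian_apply hp hDm, lintegral_cone hp hD,
    volume_pBall_inv hp, mul_assoc]

theorem nuMeasure_cone_inter_le (hp : 0 < p) {D : Set (Fin n → ℝ)} (hDm : MeasurableSet D)
    (hD : ∀ r : ℝ, 0 < r → ∀ y, r • y ∈ D ↔ y ∈ D) {r : ℝ} (hr : 0 < r) (hr1 : r ≤ 1) :
    nuMeasure n p (D ∩ {y | ∑ i, |y i| ^ p ≤ r}) =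
      ENNReal.ofReal (r ^ (n / p)) * nuMeasure n p D := by
  have hm : MeasurableSet {y : Fin n → ℝ | ∑ i, |y i| ^ p ≤ r} :=
    measurableSet_le (by fun_prop) measurable_const
  have : D ∩ {y | ∑ i, |y i| ^ p ≤ r} ∩ pBall n p = D ∩ {y | ∑ i, |y i| ^ p ≤ r} := by
    refine inter_eq_left.2 fun y hy => ?_
    rw [pBall_eq hp]
    exact le_trans hy.2 hr1
  rw [nuMeasure_apply (hDm.inter hm), nuMeasure_apply hDm, this, volume_cone_inter_le hp hD hr]
  ring

theorem rpow_neg_log_le {N t : ℝ} (hN : 0 < N) (ht : t ∈ Ioo (0 : ℝ) 1) :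
    (-Real.log t) ^ N ≤ N ^ N * Real.exp (1 - N) * t ^ (-(N / (N + 1))) := by
  have hlog : 0 < -Real.log t := neg_pos.2 (Real.log_neg ht.1 ht.2)
  set x := -Real.log t with hx
  have h1 : x ≤ (N + 1) * Real.exp (x / (N + 1) - 1) := by
    have := Real.add_one_le_exp (x / (N + 1) - 1)
    rw [sub_add_cancel, div_le_iff₀' (by positivity)] at this
    exact this
  have h2 : N + 1 ≤ N * Real.exp (1 / N) := by
    have := mul_le_mul_of_nonneg_left (Real.add_one_le_exp (1 / N)) hN.le
    rwa [mul_add, mul_one_div_cancel hN.ne', mul_one, add_comm] at this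
  have h3 : x ≤ N * Real.exp (1 / N + (x / (N + 1) - 1)) := by
    rw [Real.exp_add, ← mul_assoc]
    exact h1.trans (mul_le_mul_of_nonneg_right h2 (Real.exp_pos _).le)
  have ht' : t = Real.exp (-x) := by rw [hx, neg_neg, Real.exp_log ht.1]
  refine (Real.rpow_le_rpow hlog.le h3 hN.le).trans_eq ?_
  rw [Real.mul_rpow hN.le (Real.exp_pos _).le, ← Real.exp_mul, ht', ← Real.exp_mul, mul_assoc,
    ← Real.exp_add]
  congr 2
  field_simp
  ring

theorem radialMass_le (hp : 0 < p) (hn : 0 < n) :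
    radialMass n p ≤ ENNReal.ofReal
      ((n : ℝ) ^ (n / p : ℝ) * Real.exp (-(n / p)) * (Real.exp 1 * (n / p + 1))) := by
  have hn' : (0 : ℝ) < n := Nat.cast_pos.2 hn
  set N : ℝ := n / p with hNdef
  have hN : 0 < N := div_pos hn' hp
  have hα : -1 < -(N / (N + 1)) := by
    rw [neg_lt_neg_iff, div_lt_one (by positivity)]; linarith
  have hint : IntegrableOn (fun t : ℝ => t ^ (-(N / (N + 1)))) (Ioo 0 1) := by
    have := intervalIntegral.intervalIntegrable_rpow' (a := 0) (b := 1) hα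
    rw [intervalIntegrable_iff_integrableOn_Ioo_of_le zero_le_one] at this
    exact this
  have hval : ∫ t in Ioo (0 : ℝ) 1, t ^ (-(N / (N + 1))) = N + 1 := by
    rw [← integral_Ioc_eq_integral_Ioo, ← intervalIntegral.integral_of_le zero_le_one,
      integral_rpow (Or.inl hα), Real.one_rpow, Real.zero_rpow (by linarith)]
    field_simp
    ring
  have hnn : 0 ≤ᵐ[volume.restrict (Ioo (0 : ℝ) 1)] fun t : ℝ => t ^ (-(N / (N + 1))) := by
    filter_upwards [ae_restrict_mem measurableSet_Ioo] with t ht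
    exact Real.rpow_nonneg ht.1.le _
  have hc : 0 ≤ p ^ N * (N ^ N * Real.exp (1 - N)) := by positivity
  calc radialMass n p
      ≤ ∫⁻ t in Ioo (0 : ℝ) 1, ENNReal.ofReal (p ^ N * (N ^ N * Real.exp (1 - N))) *
          ENNReal.ofReal (t ^ (-(N / (N + 1)))) := by
        refine setLIntegral_mono' measurableSet_Ioo fun t ht => ?_
        rw [← ENNReal.ofReal_mul hc]
        refine ENNReal.ofReal_le_ofReal ?_
        have hlog : 0 < -Real.log t := neg_pos.2 (Real.log_neg ht.1 ht.2)
        rw [← mul_neg, Real.mul_rpow hp.le hlog.le, mul_assoc]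
        exact mul_le_mul_of_nonneg_left (rpow_neg_log_le hN ht) (by positivity)
    _ = ENNReal.ofReal (p ^ N * (N ^ N * Real.exp (1 - N)) * (N + 1)) := by
        rw [lintegral_const_mul _ (by fun_prop), ← ofReal_integral_eq_lintegral_ofReal hint hnn,
          hval, ← ENNReal.ofReal_mul hc]
    _ = _ := by
        congr 1
        have : (n : ℝ) = p * N := by rw [hNdef]; field_simp
        rw [this, Real.mul_rpow hp.le hN.le, sub_eq_add_neg, Real.exp_add]
        ring

/-- The uniform distribution on the ball is dominated, up to a polynomial factor, by the
`p`-Gaussian product restricted to the ball of radius `n ^ (1 / p)`. -/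
theorem nuMeasure_le (hp : 0 < p) (hn : 0 < n) {S T : Set (Fin n → ℝ)} (hS : MeasurableSet S)
    (hT : MeasurableSet T) (hTn : T ⊆ {y | ∑ i, |y i| ^ p ≤ n})
    (hST : ∀ x ∈ pBall n p, x ∈ S → (n : ℝ) ^ (1 / p) • x ∈ T) :
    nuMeasure n p S ≤ ENNReal.ofReal (Real.exp 1 * (n / p + 1)) *
      (Measure.pi fun _ : Fin n => pGaussian p) T := by
  have hn' : (0 : ℝ) < n := Nat.cast_pos.2 hn
  set N : ℝ := n / p with hNdef
  have hN : 0 < N := div_pos hn' hp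
  set c : ℝ≥0∞ := ENNReal.ofReal ((2 * (p ^ (1 / p) * Real.Gamma (1 + 1 / p)))⁻¹ ^ n) with hc
  have hr : 0 < (n : ℝ) ^ (1 / p) := Real.rpow_pos_of_pos hn' _
  have h1 : volume (S ∩ pBall n p) ≤ ENNReal.ofReal ((n : ℝ) ^ (-N)) * volume T := by
    have : S ∩ pBall n p ⊆ ((n : ℝ) ^ (1 / p) • ·) ⁻¹' T := fun x hx => hST x hx.2 hx.1
    refine (measure_mono this).trans_eq ?_
    rw [Measure.addHaar_preimage_smul _ hr.ne', Module.finrank_fin_fun]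
    congr 2
    rw [abs_of_pos (by positivity), ← Real.rpow_natCast, ← Real.rpow_mul hn'.le,
      ← Real.rpow_neg hn'.le]
    congr 1
    rw [hNdef]; ring
  have h2 : ENNReal.ofReal (Real.exp (-N)) * volume T ≤
      ∫⁻ y in T, ENNReal.ofReal (Real.exp (-(1 / p) * ∑ i, |y i| ^ p)) := by
    rw [← setLIntegral_const]
    refine setLIntegral_mono' hT fun y hy => ENNReal.ofReal_le_ofReal (Real.exp_le_exp.2 ?_)
    have h3 : ∑ i, |y i| ^ p ≤ n := hTn hy
    rw [neg_mul, neg_le_neg_iff, hNdef, one_div, ← div_eq_inv_mul]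
    exact div_le_div_of_nonneg_right h3 hp.le
  calc nuMeasure n p S
      ≤ c * ENNReal.ofReal ((n : ℝ) ^ N * Real.exp (-N) * (Real.exp 1 * (N + 1))) *
          (ENNReal.ofReal ((n : ℝ) ^ (-N)) * volume T) := by
        rw [nuMeasure_apply hS, volume_pBall_inv hp]
        gcongr
        exact radialMass_le hp hn
    _ = ENNReal.ofReal (Real.exp 1 * (N + 1)) *
          (c * (ENNReal.ofReal (Real.exp (-N)) * volume T)) := by
        have h4 : (n : ℝ) ^ N * Real.exp (-N) * (Real.exp 1 * (N + 1)) * (n : ℝ) ^ (-N) =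
            (Real.exp 1 * (N + 1)) * Real.exp (-N) := by
          rw [Real.rpow_neg hn'.le]
          field_simp
        calc _ = c * (ENNReal.ofReal ((n : ℝ) ^ N * Real.exp (-N) * (Real.exp 1 * (N + 1))) *
              ENNReal.ofReal ((n : ℝ) ^ (-N))) * volume T := by ring
          _ = _ := by
            rw [← ENNReal.ofReal_mul (by positivity), h4, ENNReal.ofReal_mul (by positivity)]
            ring
    _ ≤ _ := by
        rw [pi_pGaussian_apply hp hT]
        gcongr

end Comparison

section Tails

theorem eventually_mul_exp_neg_rpow_le {r c₁ c₂ : ℝ} (hr : 0 < r) (hc : c₂ < c₁) (a b : ℝ) :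
    ∀ᶠ n : ℕ in atTop, (a * n + b) * Real.exp (-c₁ * (n : ℝ) ^ r) ≤
      Real.exp (-c₂ * (n : ℝ) ^ r) := by
  have hd : 0 < c₁ - c₂ := sub_pos.2 hc
  have h1 : Tendsto (fun x : ℝ => x * Real.exp (-(c₁ - c₂) * x ^ r)) atTop (𝓝 0) := by
    have h := (tendsto_rpow_mul_exp_neg_mul_atTop_nhds_zero (1 / r) (c₁ - c₂) hd).comp
      (tendsto_rpow_atTop hr)
    refine h.congr' ?_
    filter_upwards [eventually_gt_atTop 0] with x hx
    simp only [Function.comp_apply]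
    rw [← Real.rpow_mul hx.le, mul_one_div_cancel hr.ne', Real.rpow_one]
  have h2 : Tendsto (fun x : ℝ => Real.exp (-(c₁ - c₂) * x ^ r)) atTop (𝓝 0) := by
    refine Real.tendsto_exp_atBot.comp ?_
    exact (tendsto_rpow_atTop hr).const_mul_atTop_of_neg (by linarith)
  have h3 := ((h1.const_mul a).add (h2.const_mul b)).comp tendsto_natCast_atTop_atTop
  rw [mul_zero, mul_zero, add_zero] at h3
  filter_upwards [h3.eventually (ge_mem_nhds zero_lt_one)] with n hn
  simp only [Function.comp_apply] at hn
  have h4 : (a * n + b) * Real.exp (-(c₁ - c₂) * (n : ℝ) ^ r) ≤ 1 := by linarith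
  have h5 : Real.exp (-c₁ * (n : ℝ) ^ r) =
      Real.exp (-(c₁ - c₂) * (n : ℝ) ^ r) * Real.exp (-c₂ * (n : ℝ) ^ r) := by
    rw [← Real.exp_add]; congr 1; ring
  rw [h5, ← mul_assoc]
  exact mul_le_of_le_one_left (Real.exp_pos _).le h4

theorem exp_sub_one_le_mul_exp (x : ℝ) : Real.exp x - 1 ≤ x * Real.exp x := by
  have h := mul_le_mul_of_nonneg_right (Real.add_one_le_exp (-x)) (Real.exp_pos x).le
  rw [← Real.exp_add, neg_add_cancel, Real.exp_zero] at h
  linarith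

/-- First-order expansion of exponential moments under a domination hypothesis. -/
theorem eventually_lintegral_exp_le {μ : Measure ℝ} [IsProbabilityMeasure μ] {X : ℕ → ℝ → ℝ}
    {Y G : ℝ → ℝ} {θ : ℕ → ℝ} {B : ℝ} (hX : ∀ n, Measurable (X n))
    (hXY : ∀ y, Tendsto (fun n => X n y) atTop (𝓝 (Y y))) (hθ : Tendsto θ atTop (𝓝 0))
    (hθ0 : ∀ᶠ n in atTop, 0 < θ n) (hG : Integrable G μ)
    (hXG : ∀ᶠ n in atTop, ∀ y, |X n y| * Real.exp (max (θ n * X n y) 0) ≤ G y)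
    (hB : ∫ y, Y y ∂μ < B) :
    ∀ᶠ n in atTop, ∫⁻ y, ENNReal.ofReal (Real.exp (θ n * X n y)) ∂μ ≤
      ENNReal.ofReal (Real.exp (θ n * B)) := by
  set F : ℕ → ℝ → ℝ := fun n y => (θ n)⁻¹ * (Real.exp (θ n * X n y) - 1) with hF
  have hFm : ∀ n, Measurable (F n) := fun n => by have := hX n; fun_prop
  have hlow : ∀ᶠ n in atTop, ∀ y, X n y ≤ F n y := by
    filter_upwards [hθ0] with n hn y
    rw [hF]
    dsimp only
    rw [← div_eq_inv_mul, le_div_iff₀' hn]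
    linarith [Real.add_one_le_exp (θ n * X n y)]
  have hup : ∀ᶠ n in atTop, ∀ y, F n y ≤ X n y * Real.exp (θ n * X n y) := by
    filter_upwards [hθ0] with n hn y
    rw [hF]
    dsimp only
    rw [← div_eq_inv_mul, div_le_iff₀' hn, ← mul_assoc]
    exact exp_sub_one_le_mul_exp _
  have hdom : ∀ᶠ n in atTop, ∀ y, |F n y| ≤ G y := by
    filter_upwards [hlow, hup, hXG] with n h1 h2 h3 y
    refine le_trans (abs_le.2 ⟨?_, ?_⟩) (h3 y)
    · have h4 : |X n y| ≤ |X n y| * Real.exp (max (θ n * X n y) 0) :=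
        le_mul_of_one_le_right (abs_nonneg _) (Real.one_le_exp (le_max_right _ _))
      linarith [h1 y, neg_abs_le (X n y)]
    · refine (h2 y).trans ?_
      exact mul_le_mul (le_abs_self _) (Real.exp_le_exp.2 (le_max_left _ _)) (Real.exp_pos _).le
        (abs_nonneg _)
  have hlim : ∀ y, Tendsto (fun n => F n y) atTop (𝓝 (Y y)) := by
    intro y
    have h1 : Tendsto (fun n => X n y * Real.exp (θ n * X n y)) atTop (𝓝 (Y y)) := by
      have := (hXY y).mul ((Real.continuous_exp.tendsto _).comp (hθ.mul (hXY y)))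
      simpa using this
    refine tendsto_of_tendsto_of_tendsto_of_le_of_le' (hXY y) h1 ?_ ?_
    · filter_upwards [hlow] with n hn using hn y
    · filter_upwards [hup] with n hn using hn y
  have hint : Tendsto (fun n => ∫ y, F n y ∂μ) atTop (𝓝 (∫ y, Y y ∂μ)) := by
    refine tendsto_integral_filter_of_dominated_convergence G
      (Eventually.of_forall fun n => (hFm n).aestronglyMeasurable) ?_ hG
      (Eventually.of_forall hlim)
    filter_upwards [hdom] with n hn
    exact Eventually.of_forall hn
  filter_upwards [hint.eventually (gt_mem_nhds hB), hdom, hθ0] with n h1 h2 h3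
  have hFi : Integrable (F n) μ :=
    hG.mono' (hFm n).aestronglyMeasurable (Eventually.of_forall h2)
  have he : ∀ y, Real.exp (θ n * X n y) = 1 + θ n * F n y := by
    intro y
    rw [hF]
    dsimp only
    rw [mul_inv_cancel_left₀ h3.ne']
    ring
  have hi : Integrable (fun y => Real.exp (θ n * X n y)) μ := by
    simp_rw [he]
    exact (integrable_const _).add (hFi.const_mul _)
  rw [← ofReal_integral_eq_lintegral_ofReal hi (Eventually.of_forall fun y => (Real.exp_pos _).le)]
  refine ENNReal.ofReal_le_ofReal ?_
  simp_rw [he]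
  rw [integral_add (integrable_const _) (hFi.const_mul _), integral_const_mul]
  simp only [integral_const, probReal_univ, smul_eq_mul, mul_one]
  have := mul_le_mul_of_nonneg_left h1.le h3.le
  linarith [Real.add_one_le_exp (θ n * B)]

variable {p q : ℝ}

theorem pGaussian_lower_tail (hp : 0 < p) (hq : 0 < q) {b : ℝ} (hb : b < Mp p q) :
    ∃ c > 0, ∀ n : ℕ, (Measure.pi fun _ : Fin n => pGaussian p) {y | ∑ i, |y i| ^ q ≤ n * b} ≤
      ENNReal.ofReal (Real.exp (-c * n)) := by
  have := isProbabilityMeasure_pGaussian hp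
  obtain ⟨b', hb1, hb2⟩ := exists_between hb
  have h := eventually_lintegral_exp_le (μ := pGaussian p) (X := fun _ y => -|y| ^ q)
    (Y := fun y => -|y| ^ q) (G := fun y => |y| ^ q) (θ := fun n : ℕ => 1 / ((n : ℝ) + 1))
    (B := -b') (fun _ => by fun_prop) (fun y => tendsto_const_nhds)
    tendsto_one_div_add_atTop_nhds_zero_nat (Eventually.of_forall fun n => by positivity)
    (integrable_pGaussian_rpow hp hq.le) (Eventually.of_forall fun n y => by
      have h1 : 0 ≤ 1 / ((n : ℝ) + 1) * |y| ^ q := by positivity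
      rw [abs_neg, abs_of_nonneg (by positivity : 0 ≤ |y| ^ q), max_eq_right (by linarith),
        Real.exp_zero, mul_one])
    (by rw [integral_neg, integral_pGaussian_rpow hp hq.le]; linarith)
  obtain ⟨k, hk⟩ := h.exists
  set l : ℝ := 1 / ((k : ℝ) + 1) with hl
  have hl0 : 0 < l := by positivity
  refine ⟨l * (b' - b), mul_pos hl0 (sub_pos.2 hb1), fun n => ?_⟩
  have h2 := pi_sum_ge_le (n := n) (pGaussian p) (fun y => l * -|y| ^ q) (by fun_prop)
    (-(l * (n * b)))
  have h3 : {y : Fin n → ℝ | -(l * (n * b)) ≤ ∑ i, l * -|y i| ^ q} =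
      {y | ∑ i, |y i| ^ q ≤ n * b} := by
    ext y
    simp only [mem_ofPred_eq]
    rw [← Finset.mul_sum, Finset.sum_neg_distrib, mul_neg, neg_le_neg_iff,
      mul_le_mul_iff_right₀ hl0]
  rw [h3] at h2
  refine h2.trans ?_
  calc _ ≤ ENNReal.ofReal (Real.exp (-(-(l * (n * b))))) *
        (ENNReal.ofReal (Real.exp (l * -b'))) ^ n := by gcongr
    _ = _ := by
      rw [← ENNReal.ofReal_pow (Real.exp_pos _).le, ← Real.exp_nat_mul,
        ← ENNReal.ofReal_mul (Real.exp_pos _).le, ← Real.exp_add]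
      congr 2
      ring

theorem pGaussian_abs_rpow_gt_le (hp : 0 < p) (hq : 0 < q) {κ : ℝ} (hκ0 : 0 < κ) (hκ : κ < 1) :
    ∃ C > 0, ∀ z > 0, pGaussian p {y | z < |y| ^ q} ≤
      ENNReal.ofReal (C * Real.exp (-(κ / p * z ^ (p / q)))) := by
  have hi := integrable_pGaussian_rpow_mul_exp hp (s := 0) le_rfl hκ
  simp only [Real.rpow_zero, one_mul] at hi
  refine ⟨∫ y, Real.exp (κ / p * |y| ^ p) ∂(pGaussian p) + 1, ?_, fun z hz => ?_⟩
  · have : 0 ≤ ∫ y, Real.exp (κ / p * |y| ^ p) ∂(pGaussian p) :=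
      integral_nonneg fun y => (Real.exp_pos _).le
    linarith
  have h1 : ∀ y, z < |y| ^ q → κ / p * z ^ (p / q) ≤ κ / p * |y| ^ p := fun y hy => by
    have h2 := Real.rpow_le_rpow hz.le hy.le (div_nonneg hp.le hq.le)
    rw [← Real.rpow_mul (abs_nonneg _), mul_div_cancel₀ _ hq.ne'] at h2
    gcongr
  have h2 := mul_meas_ge_le_lintegral (μ := pGaussian p)
    (f := fun y => ENNReal.ofReal (Real.exp (κ / p * |y| ^ p))) (by fun_prop)
    (ENNReal.ofReal (Real.exp (κ / p * z ^ (p / q))))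
  rw [← ofReal_integral_eq_lintegral_ofReal hi
    (Eventually.of_forall fun y => (Real.exp_pos _).le)] at h2
  have h3 : pGaussian p {y | z < |y| ^ q} ≤ pGaussian p {y | ENNReal.ofReal
      (Real.exp (κ / p * z ^ (p / q))) ≤ ENNReal.ofReal (Real.exp (κ / p * |y| ^ p))} :=
    measure_mono fun y hy => ENNReal.ofReal_le_ofReal (Real.exp_le_exp.2 (h1 y hy))
  calc _ = ENNReal.ofReal (Real.exp (-(κ / p * z ^ (p / q)))) *
        (ENNReal.ofReal (Real.exp (κ / p * z ^ (p / q))) * pGaussian p {y | z < |y| ^ q}) := by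
        rw [← mul_assoc, ← ENNReal.ofReal_mul (Real.exp_pos _).le, ← Real.exp_add,
          neg_add_cancel, Real.exp_zero, ENNReal.ofReal_one, one_mul]
    _ ≤ ENNReal.ofReal (Real.exp (-(κ / p * z ^ (p / q)))) *
        ENNReal.ofReal (∫ y, Real.exp (κ / p * |y| ^ p) ∂(pGaussian p) + 1) := by
        gcongr
        exact ((mul_le_mul_right h3 _).trans h2).trans (ENNReal.ofReal_le_ofReal (by linarith))
    _ = _ := by
        rw [← ENNReal.ofReal_mul (Real.exp_pos _).le, mul_comm]

/-- Stretched-exponential upper tail of the sum of `|Y i| ^ q`. -/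
theorem pGaussian_upper_tail (hp : 0 < p) (hpq : p < q) {t c : ℝ} (ht : 0 < t)
    (hc : c < 1 / p * t ^ (p / q)) :
    ∀ᶠ n : ℕ in atTop, (Measure.pi fun _ : Fin n => pGaussian p)
      {y | n * (Mp p q + t) ≤ ∑ i, |y i| ^ q} ≤
        ENNReal.ofReal (Real.exp (-c * (n : ℝ) ^ (p / q))) := by
  have := isProbabilityMeasure_pGaussian hp
  have hq : 0 < q := hp.trans hpq
  set r := p / q with hr
  have hr0 : 0 < r := div_pos hp hq
  have hr1 : r < 1 := (div_lt_one hq).2 hpq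
  set M := Mp p q with hM
  obtain ⟨κ, hκ0, hκ1, hκc⟩ : ∃ κ : ℝ, 0 < κ ∧ κ < 1 ∧ c < κ * κ * (1 / p * t ^ r) := by
    have h1 : Tendsto (fun κ : ℝ => κ * κ * (1 / p * t ^ r)) (𝓝[<] 1)
        (𝓝 (1 * 1 * (1 / p * t ^ r))) :=
      ((tendsto_id.mul tendsto_id).mul_const _).mono_left nhdsWithin_le_nhds
    rw [one_mul, one_mul] at h1
    have h3 : ∀ᶠ κ : ℝ in 𝓝[<] 1, κ < 1 := self_mem_nhdsWithin
    have h4 : ∀ᶠ κ : ℝ in 𝓝[<] 1, 0 < κ := mem_nhdsWithin_of_mem_nhds (lt_mem_nhds one_pos)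
    obtain ⟨κ, h2, h3, h4⟩ := ((h1.eventually (lt_mem_nhds hc)).and (h3.and h4)).exists
    exact ⟨κ, h4, h3, h2⟩
  obtain ⟨C, hC0, hC⟩ := pGaussian_abs_rpow_gt_le hp hq hκ0 hκ1
  set X : ℕ → ℝ → ℝ := fun n y => if |y| ^ q ≤ n * t then |y| ^ q else 0 with hX
  set θ : ℕ → ℝ := fun n => κ / p * (n * t) ^ (r - 1) with hθ
  have hXm : ∀ n, Measurable (X n) := fun n =>
    Measurable.ite (measurableSet_le (by fun_prop) measurable_const) (by fun_prop)
      measurable_const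
  have hnt : Tendsto (fun n : ℕ => (n : ℝ) * t) atTop atTop :=
    tendsto_natCast_atTop_atTop.atTop_mul_const ht
  have hmgf := eventually_lintegral_exp_le (μ := pGaussian p) (X := X) (Y := fun y => |y| ^ q)
    (G := fun y => |y| ^ q * Real.exp (κ / p * |y| ^ p)) (θ := θ) (B := M + (1 - κ) * t) hXm
    (fun y => by
      refine tendsto_const_nhds.congr' ?_
      filter_upwards [hnt.eventually_ge_atTop (|y| ^ q)] with n hn
      exact (if_pos hn).symm)
    (by
      have := ((tendsto_rpow_neg_atTop (sub_pos.2 hr1)).comp hnt).const_mul (κ / p)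
      rw [mul_zero] at this
      refine this.congr fun n => ?_
      simp [hθ])
    (by
      filter_upwards [eventually_gt_atTop 0] with n hn
      have : (0 : ℝ) < n := Nat.cast_pos.2 hn
      positivity)
    (integrable_pGaussian_rpow_mul_exp hp hq.le hκ1)
    (by
      filter_upwards [eventually_gt_atTop 0] with n hn y
      have hn' : (0 : ℝ) < n := Nat.cast_pos.2 hn
      simp only [hX]
      split_ifs with hy
      · rw [abs_of_nonneg (by positivity)]
        refine mul_le_mul_of_nonneg_left (Real.exp_le_exp.2 (max_le ?_ (by positivity)))
          (by positivity)
        rcases eq_or_ne y 0 with rfl | hy0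
        · simp [Real.zero_rpow hq.ne', Real.zero_rpow hp.ne']
        have hz : 0 < |y| ^ q := Real.rpow_pos_of_pos (abs_pos.2 hy0) _
        have h1 := Real.rpow_le_rpow_of_nonpos hz hy (by linarith : r - 1 ≤ 0)
        rw [hθ]
        dsimp only
        rw [mul_assoc]
        refine mul_le_mul_of_nonneg_left ?_ (by positivity)
        refine (mul_le_mul_of_nonneg_right h1 hz.le).trans_eq ?_
        rw [← Real.rpow_add_one hz.ne', sub_add_cancel, ← Real.rpow_mul (abs_nonneg _), hr,
          mul_div_cancel₀ _ hq.ne']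
      · rw [abs_zero, zero_mul]
        positivity)
    (by
      rw [integral_pGaussian_rpow hp hq.le]
      have : 0 < (1 - κ) * t := mul_pos (by linarith) ht
      linarith)
  filter_upwards [hmgf, eventually_gt_atTop 0, eventually_mul_exp_neg_rpow_le hr0 hκc C 1]
    with n h1 hn h2
  have hn' : (0 : ℝ) < n := Nat.cast_pos.2 hn
  have hsub : {y : Fin n → ℝ | n * (M + t) ≤ ∑ i, |y i| ^ q} ⊆
      (⋃ i : Fin n, (fun y : Fin n → ℝ => y i) ⁻¹' {z | n * t < |z| ^ q}) ∪
        {y | θ n * (n * (M + t)) ≤ ∑ i, θ n * X n (y i)} := by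
    intro y hy
    by_cases h : ∃ i, n * t < |y i| ^ q
    · left
      obtain ⟨i, hi⟩ := h
      exact mem_iUnion.2 ⟨i, hi⟩
    · right
      push Not at h
      simp only [mem_ofPred_eq]
      rw [← Finset.mul_sum]
      refine mul_le_mul_of_nonneg_left ?_ (by positivity)
      refine le_trans hy (Finset.sum_le_sum fun i _ => ?_)
      simp only [hX]
      rw [if_pos (h i)]
  have hA : (Measure.pi fun _ : Fin n => pGaussian p)
      (⋃ i : Fin n, (fun y : Fin n → ℝ => y i) ⁻¹' {z | n * t < |z| ^ q}) ≤
        ENNReal.ofReal (n * (C * Real.exp (-(κ * κ * (1 / p * t ^ r)) * (n : ℝ) ^ r))) := by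
    refine (measure_iUnion_le _).trans ?_
    have h3 : ∀ i : Fin n, (Measure.pi fun _ : Fin n => pGaussian p)
        ((fun y : Fin n → ℝ => y i) ⁻¹' {z | n * t < |z| ^ q}) ≤
          ENNReal.ofReal (C * Real.exp (-(κ * κ * (1 / p * t ^ r)) * (n : ℝ) ^ r)) := by
      intro i
      rw [(measurePreserving_eval (fun _ : Fin n => pGaussian p) i).measure_preimage
        (measurableSet_lt measurable_const (by fun_prop)).nullMeasurableSet]
      refine (hC (n * t) (by positivity)).trans (ENNReal.ofReal_le_ofReal ?_)
      refine mul_le_mul_of_nonneg_left (Real.exp_le_exp.2 ?_) hC0.le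
      rw [Real.mul_rpow hn'.le ht.le, neg_mul, neg_le_neg_iff]
      have h4 : κ * κ ≤ κ := by nlinarith
      calc κ * κ * (1 / p * t ^ r) * (n : ℝ) ^ r ≤ κ * (1 / p * t ^ r) * (n : ℝ) ^ r := by gcongr
        _ = _ := by ring
    rw [tsum_fintype]
    refine (Finset.sum_le_sum fun i _ => h3 i).trans_eq ?_
    rw [Finset.sum_const, Finset.card_univ, Fintype.card_fin, nsmul_eq_mul,
      ENNReal.ofReal_mul (p := (n : ℝ)) hn'.le, ENNReal.ofReal_natCast]
  have hB : (Measure.pi fun _ : Fin n => pGaussian p)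
      {y | θ n * (n * (M + t)) ≤ ∑ i, θ n * X n (y i)} ≤
        ENNReal.ofReal (Real.exp (-(κ * κ * (1 / p * t ^ r)) * (n : ℝ) ^ r)) := by
    refine (pi_sum_ge_le (pGaussian p) (fun y => θ n * X n y)
      ((hXm n).const_mul _) (θ n * (n * (M + t)))).trans ?_
    calc _ ≤ ENNReal.ofReal (Real.exp (-(θ n * (n * (M + t))))) *
          (ENNReal.ofReal (Real.exp (θ n * (M + (1 - κ) * t)))) ^ n := by gcongr
      _ = _ := by
        rw [← ENNReal.ofReal_pow (Real.exp_pos _).le, ← Real.exp_nat_mul,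
          ← ENNReal.ofReal_mul (Real.exp_pos _).le, ← Real.exp_add]
        congr 2
        have h5 : θ n * (n * t) = κ / p * (t ^ r * (n : ℝ) ^ r) := by
          rw [hθ]
          dsimp only
          rw [mul_assoc, ← Real.rpow_add_one (by positivity), sub_add_cancel,
            Real.mul_rpow hn'.le ht.le, mul_comm ((n : ℝ) ^ r)]
        calc _ = -(κ * (θ n * (n * t))) := by ring
          _ = _ := by rw [h5]; ring
  refine (measure_mono hsub).trans ((measure_union_le _ _).trans ((add_le_add hA hB).trans ?_))
  rw [← ENNReal.ofReal_add (by positivity) (by positivity)]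
  refine ENNReal.ofReal_le_ofReal (le_trans (le_of_eq ?_) h2)
  ring

end Tails

section Bounds

variable {p q : ℝ} {n : ℕ}

theorem measurable_pnorm : Measurable fun x : Fin n → ℝ => pnorm q x := by
  unfold pnorm
  fun_prop

theorem pnorm_nonneg (x : Fin n → ℝ) : 0 ≤ pnorm q x :=
  Real.rpow_nonneg (Finset.sum_nonneg fun i _ => by positivity) _

theorem pnorm_rpow (hq : 0 < q) (x : Fin n → ℝ) : pnorm q x ^ q = ∑ i, |x i| ^ q := by
  rw [pnorm, ← Real.rpow_mul (Finset.sum_nonneg fun i _ => by positivity),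
    one_div_mul_cancel hq.ne', Real.rpow_one]

theorem sum_scaled_rpow (hp : 0 < p) (hq : 0 < q) (hn : 0 < n) (x : Fin n → ℝ) :
    ∑ i, |((n : ℝ) ^ (1 / p) • x) i| ^ q = n * ((n : ℝ) ^ (1 / p - 1 / q) * pnorm q x) ^ q := by
  have hn' : (0 : ℝ) < n := Nat.cast_pos.2 hn
  rw [sum_abs_smul_rpow (by positivity), Real.mul_rpow (by positivity) (pnorm_nonneg x),
    pnorm_rpow hq, ← mul_assoc, ← Real.rpow_mul hn'.le, ← Real.rpow_mul hn'.le,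
    ← Real.rpow_one_add' hn'.le]
  · congr 2
    field_simp
    ring
  · have : 1 + (1 / p - 1 / q) * q = q / p := by field_simp; ring
    rw [this]
    positivity

theorem sum_scaled_rpow_self (hp : 0 < p) (x : Fin n → ℝ) :
    ∑ i, |((n : ℝ) ^ (1 / p) • x) i| ^ p = n * ∑ i, |x i| ^ p := by
  rw [sum_abs_smul_rpow (by positivity), ← Real.rpow_mul (Nat.cast_nonneg _),
    one_div_mul_cancel hp.ne', Real.rpow_one]

theorem mpq_rpow (hp : 0 < p) (hq : 0 < q) : mpq p q ^ q = Mp p q := by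
  rw [mpq, ← Real.rpow_mul (Mp_pos hp hq.le).le, one_div_mul_cancel hq.ne', Real.rpow_one]

theorem mpq_pos (hp : 0 < p) (hq : 0 < q) : 0 < mpq p q :=
  Real.rpow_pos_of_pos (Mp_pos hp hq.le) _

theorem map_Ici_le (hp : 0 < p) (hpq : p < q) {a c : ℝ} (ha : mpq p q < a)
    (hc : c < 1 / p * (a ^ q - mpq p q ^ q) ^ (p / q)) :
    ∀ᶠ n : ℕ in atTop, (nuMeasure n p).map
      (fun x => (n : ℝ) ^ (1 / p - 1 / q) * pnorm q x) (Ici a) ≤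
        ENNReal.ofReal (Real.exp (-c * (n : ℝ) ^ (p / q))) := by
  have hq : 0 < q := hp.trans hpq
  have ha0 : 0 < a := (mpq_pos hp hq).trans ha
  obtain ⟨c₁, hc₁, hc₂⟩ := exists_between hc
  rw [mpq_rpow hp hq] at hc₂
  have ht : 0 < a ^ q - Mp p q := by
    rw [← mpq_rpow hp hq, sub_pos]
    exact Real.rpow_lt_rpow (mpq_pos hp hq).le ha hq
  filter_upwards [pGaussian_upper_tail hp hpq ht hc₂, eventually_gt_atTop 0,
    eventually_mul_exp_neg_rpow_le (div_pos hp hq) hc₁ (Real.exp 1 / p) (Real.exp 1)]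
    with n h1 hn h2
  have hn' : (0 : ℝ) < n := Nat.cast_pos.2 hn
  have hm : Measurable fun x : Fin n → ℝ => (n : ℝ) ^ (1 / p - 1 / q) * pnorm q x :=
    measurable_pnorm.const_mul _
  rw [Measure.map_apply hm measurableSet_Ici]
  have h3 := nuMeasure_le hp hn (hm measurableSet_Ici)
    (T := {y | ∑ i, |y i| ^ p ≤ n} ∩ {y | n * a ^ q ≤ ∑ i, |y i| ^ q})
    ((measurableSet_le (by fun_prop) measurable_const).inter
      (measurableSet_le measurable_const (by fun_prop))) inter_subset_left
    (fun x hx hxa => by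
      rw [pBall_eq hp] at hx
      refine ⟨?_, ?_⟩ <;> simp only [mem_ofPred_eq]
      · rw [sum_scaled_rpow_self hp]
        exact mul_le_of_le_one_right hn'.le hx
      · rw [sum_scaled_rpow hp hq hn]
        exact mul_le_mul_of_nonneg_left (Real.rpow_le_rpow ha0.le hxa hq.le) hn'.le)
  rw [add_sub_cancel] at h1
  refine h3.trans ((mul_le_mul_right ((measure_mono inter_subset_right).trans h1) _).trans ?_)
  rw [← ENNReal.ofReal_mul (by positivity)]
  refine ENNReal.ofReal_le_ofReal (le_trans (le_of_eq ?_) h2)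
  ring

theorem map_Iic_le (hp : 0 < p) (hpq : p < q) {b : ℝ} (hb : b < mpq p q) (c : ℝ) :
    ∀ᶠ n : ℕ in atTop, (nuMeasure n p).map
      (fun x => (n : ℝ) ^ (1 / p - 1 / q) * pnorm q x) (Iic b) ≤
        ENNReal.ofReal (Real.exp (-c * (n : ℝ) ^ (p / q))) := by
  have hq : 0 < q := hp.trans hpq
  have hr1 : p / q < 1 := (div_lt_one hq).2 hpq
  have hb' : max b 0 < mpq p q := max_lt hb (mpq_pos hp hq)
  have hbM : max b 0 ^ q < Mp p q := by
    rw [← mpq_rpow hp hq]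
    exact Real.rpow_lt_rpow (le_max_right _ _) hb' hq
  obtain ⟨d, hd, hP⟩ := pGaussian_lower_tail hp hq hbM
  have hlim : ∀ᶠ n : ℕ in atTop, c ≤ d / 2 * (n : ℝ) ^ (1 - p / q) :=
    (((tendsto_rpow_atTop (sub_pos.2 hr1)).const_mul_atTop (half_pos hd)).comp
      tendsto_natCast_atTop_atTop).eventually_ge_atTop c
  filter_upwards [hlim, eventually_gt_atTop 0,
    eventually_mul_exp_neg_rpow_le one_pos (half_lt_self hd) (Real.exp 1 / p) (Real.exp 1)]
    with n h1 hn h2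
  have hn' : (0 : ℝ) < n := Nat.cast_pos.2 hn
  have hm : Measurable fun x : Fin n → ℝ => (n : ℝ) ^ (1 / p - 1 / q) * pnorm q x :=
    measurable_pnorm.const_mul _
  rw [Measure.map_apply hm measurableSet_Iic]
  have h3 := nuMeasure_le hp hn (hm measurableSet_Iic)
    (T := {y | ∑ i, |y i| ^ p ≤ n} ∩ {y | ∑ i, |y i| ^ q ≤ n * max b 0 ^ q})
    ((measurableSet_le (by fun_prop) measurable_const).inter
      (measurableSet_le (by fun_prop) measurable_const)) inter_subset_left
    (fun x hx hxa => by
      rw [pBall_eq hp] at hx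
      refine ⟨?_, ?_⟩ <;> simp only [mem_ofPred_eq]
      · rw [sum_scaled_rpow_self hp]
        exact mul_le_of_le_one_right hn'.le hx
      · rw [sum_scaled_rpow hp hq hn]
        exact mul_le_mul_of_nonneg_left (Real.rpow_le_rpow
          (mul_nonneg (by positivity) (pnorm_nonneg x)) (le_trans hxa (le_max_left _ _)) hq.le)
          hn'.le)
  refine h3.trans ((mul_le_mul_right ((measure_mono inter_subset_right).trans (hP n)) _).trans ?_)
  rw [← ENNReal.ofReal_mul (by positivity)]
  rw [Real.rpow_one] at h2
  refine ENNReal.ofReal_le_ofReal (le_trans (le_trans (le_of_eq ?_) h2) (Real.exp_le_exp.2 ?_))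
  · ring
  · rw [neg_mul, neg_mul, neg_le_neg_iff]
    calc c * (n : ℝ) ^ (p / q) ≤ d / 2 * (n : ℝ) ^ (1 - p / q) * (n : ℝ) ^ (p / q) := by gcongr
      _ = d / 2 * n := by
        rw [mul_assoc, ← Real.rpow_add hn', sub_add_cancel, Real.rpow_one]

theorem tendsto_pi_pGaussian_deviation (hp : 0 < p) {s η : ℝ} (hs : 0 ≤ s) (hη : 0 < η) :
    Tendsto (fun k : ℕ => (Measure.pi fun _ : Fin k => pGaussian p)
      {y | η * (k + 1 : ℕ) ≤ |∑ i, |y i| ^ s - k * Mp p s|}) atTop (𝓝 0) := by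
  have := isProbabilityMeasure_pGaussian hp
  set V := ProbabilityTheory.variance (fun y : ℝ => |y| ^ s) (pGaussian p) with hV
  have hV0 : 0 ≤ V := ProbabilityTheory.variance_nonneg _ _
  have hbound : ∀ k : ℕ, (Measure.pi fun _ : Fin k => pGaussian p)
      {y | η * (k + 1 : ℕ) ≤ |∑ i, |y i| ^ s - k * Mp p s|} ≤
        ENNReal.ofReal (V / η ^ 2 * (1 / ((k : ℝ) + 1))) := by
    intro k
    have hmem : ∀ i : Fin k, MemLp (fun y : Fin k → ℝ => |y i| ^ s) 2
        (Measure.pi fun _ : Fin k => pGaussian p) := fun i =>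
      (memLp_pGaussian_rpow hp hs).comp_measurePreserving
        (measurePreserving_eval (fun _ : Fin k => pGaussian p) i)
    have hsum : MemLp (fun y : Fin k → ℝ => ∑ i, |y i| ^ s) 2
        (Measure.pi fun _ : Fin k => pGaussian p) := memLp_finsetSum _ fun i _ => hmem i
    have hk : 0 < η * (k + 1 : ℕ) := by positivity
    have h := ProbabilityTheory.meas_ge_le_variance_div_sq hsum hk
    have hE : ∫ y : Fin k → ℝ, ∑ i, |y i| ^ s ∂(Measure.pi fun _ : Fin k => pGaussian p) =
        k * Mp p s := by
      rw [integral_finsetSum _ fun i _ => (hmem i).integrable (by norm_num)]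
      have h1 : ∀ i : Fin k, ∫ y : Fin k → ℝ, |y i| ^ s
          ∂(Measure.pi fun _ : Fin k => pGaussian p) = Mp p s := fun i => by
        rw [integral_comp_eval (μ := fun _ : Fin k => pGaussian p) (f := fun z : ℝ => |z| ^ s)
          (by fun_prop), integral_pGaussian_rpow hp hs]
      simp [h1]
    have hvar : ProbabilityTheory.variance (fun y : Fin k → ℝ => ∑ i, |y i| ^ s)
        (Measure.pi fun _ : Fin k => pGaussian p) = k * V := by
      have h2 := ProbabilityTheory.variance_sum_pi (μ := fun _ : Fin k => pGaussian p)
        (X := fun _ z => |z| ^ s) fun _ => memLp_pGaussian_rpow hp hs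
      simp only [Finset.sum_const, Finset.card_univ, Fintype.card_fin, nsmul_eq_mul] at h2
      rw [← h2]
      congr 1
      ext y
      simp
    rw [hE, hvar] at h
    refine h.trans (ENNReal.ofReal_le_ofReal ?_)
    rw [Nat.cast_add, Nat.cast_one, div_mul_div_comm, mul_one,
      div_le_div_iff₀ (by positivity) (by positivity)]
    have : (0 : ℝ) ≤ V * η ^ 2 * (k + 1) := by positivity
    nlinarith
  have hlim : Tendsto (fun k : ℕ => ENNReal.ofReal (V / η ^ 2 * (1 / ((k : ℝ) + 1)))) atTop
      (𝓝 0) := by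
    have h3 := ENNReal.tendsto_ofReal
      (tendsto_one_div_add_atTop_nhds_zero_nat.const_mul (V / η ^ 2))
    simpa only [mul_zero, ENNReal.ofReal_zero] using h3
  exact tendsto_of_tendsto_of_tendsto_of_le_of_le tendsto_const_nhds hlim
    (fun _ => zero_le) hbound

theorem pGaussian_window_ge (hp : 0 < p) (hq : 0 < q) {t η : ℝ} (ht : 0 ≤ t) (hη : 0 < η) :
    ∃ d > 0, ∀ n : ℕ, 0 < n →
      ENNReal.ofReal (d * Real.exp (-(1 / p * (t + η) ^ (p / q)) * (n : ℝ) ^ (p / q))) ≤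
        pGaussian p {z | n * t ≤ |z| ^ q ∧ |z| ^ q ≤ n * (t + η)} := by
  set C := (2 * (p ^ (1 / p) * Real.Gamma (1 + 1 / p)))⁻¹ with hC
  have hC0 : 0 < C := inv_pos.2 (pGaussianPDF_const_pos hp)
  have hL : 0 < (t + η) ^ (1 / q) - t ^ (1 / q) :=
    sub_pos.2 (Real.rpow_lt_rpow ht (by linarith) (by positivity))
  refine ⟨C * ((t + η) ^ (1 / q) - t ^ (1 / q)), mul_pos hC0 hL, fun n hn => ?_⟩
  have hn1 : (1 : ℝ) ≤ n := Nat.one_le_cast.2 hn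
  have hn' : (0 : ℝ) < n := by linarith
  have hsub : Icc (((n : ℝ) * t) ^ (1 / q)) ((n * (t + η)) ^ (1 / q)) ⊆
      {z | n * t ≤ |z| ^ q ∧ |z| ^ q ≤ n * (t + η)} := by
    intro z hz
    have hz0 : 0 ≤ z := le_trans (by positivity) hz.1
    have h1 := Real.rpow_le_rpow (by positivity) hz.1 hq.le
    have h2 := Real.rpow_le_rpow hz0 hz.2 hq.le
    rw [← Real.rpow_mul (by positivity), one_div_mul_cancel hq.ne', Real.rpow_one] at h1 h2
    exact ⟨by rwa [abs_of_nonneg hz0], by rwa [abs_of_nonneg hz0]⟩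
  refine le_trans ?_ (measure_mono hsub)
  rw [pGaussian, withDensity_apply _ measurableSet_Icc]
  have hlow : ∀ z ∈ Icc (((n : ℝ) * t) ^ (1 / q)) ((n * (t + η)) ^ (1 / q)),
      C * Real.exp (-(1 / p * (t + η) ^ (p / q)) * (n : ℝ) ^ (p / q)) ≤ pGaussianPDF p z := by
    intro z hz
    have h2 := Real.rpow_le_rpow (by positivity : (0 : ℝ) ≤ |z| ^ q) (hsub hz).2
      (div_nonneg hp.le hq.le)
    rw [← Real.rpow_mul (abs_nonneg _), mul_div_cancel₀ _ hq.ne',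
      Real.mul_rpow hn'.le (by linarith)] at h2
    refine mul_le_mul_of_nonneg_left (Real.exp_le_exp.2 ?_) hC0.le
    rw [neg_mul, neg_mul, neg_le_neg_iff, mul_assoc, mul_comm (_ ^ (p / q))]
    exact mul_le_mul_of_nonneg_left h2 (by positivity)
  refine le_trans ?_ (setLIntegral_mono' measurableSet_Icc fun z hz =>
    ENNReal.ofReal_le_ofReal (hlow z hz))
  rw [setLIntegral_const, Real.volume_Icc, ← ENNReal.ofReal_mul (by positivity)]
  refine ENNReal.ofReal_le_ofReal ?_
  rw [mul_right_comm]
  refine mul_le_mul_of_nonneg_left ?_ (by positivity)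
  rw [Real.mul_rpow hn'.le ht, Real.mul_rpow hn'.le (by linarith), ← mul_sub]
  exact le_mul_of_one_le_left hL.le (Real.one_le_rpow hn1 (by positivity))

end Bounds

section LowerBound

variable {p q : ℝ}

theorem pnorm_smul {n : ℕ} (hq : 0 < q) {r : ℝ} (hr : 0 ≤ r) (y : Fin n → ℝ) :
    pnorm q (r • y) = r * pnorm q y := by
  rw [pnorm, sum_abs_smul_rpow hr, Real.mul_rpow (by positivity)
    (Finset.sum_nonneg fun i _ => by positivity), ← Real.rpow_mul hr,
    mul_one_div_cancel hq.ne', Real.rpow_one, pnorm]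

theorem exists_window {x t c ε : ℝ} (hp : 0 < p) (hq : 0 < q) (hx : 0 < x)
    (hc : 1 / p * t ^ (p / q) < c) (hε : 0 < ε) :
    ∃ η > 0, 1 / p * (t + η) ^ (p / q) < c ∧ ∀ u v : ℝ, |u - x ^ q| < 2 * η → |v - 1| < 2 * η →
      0 < v ∧ |u ^ (1 / q) / v ^ (1 / p) - x| < ε := by
  have h1 : ∀ᶠ η in 𝓝 (0 : ℝ), 1 / p * (t + η) ^ (p / q) < c := by
    have hcont : ContinuousAt (fun η : ℝ => 1 / p * (t + η) ^ (p / q)) 0 :=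
      continuousAt_const.mul ((continuousAt_const.add continuousAt_id).rpow_const
        (Or.inr (by positivity)))
    exact hcont.eventually_lt_const (by simpa using hc)
  have h2 : ∀ᶠ z : ℝ × ℝ in 𝓝 (x ^ q, 1), 0 < z.2 ∧ |z.1 ^ (1 / q) / z.2 ^ (1 / p) - x| < ε := by
    have hcont : ContinuousAt (fun z : ℝ × ℝ => |z.1 ^ (1 / q) / z.2 ^ (1 / p) - x|)
        (x ^ q, 1) := by
      refine ((ContinuousAt.div ?_ ?_ (by simp)).sub continuousAt_const).abs
      · exact continuousAt_fst.rpow_const (Or.inr (by positivity))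
      · exact continuousAt_snd.rpow_const (Or.inr (by positivity))
    refine ((continuous_snd.tendsto (x ^ q, (1 : ℝ))).eventually_const_lt one_pos).and
      (hcont.eventually_lt_const ?_)
    simp only [Real.one_rpow, div_one]
    rw [← Real.rpow_mul hx.le, mul_one_div_cancel hq.ne', Real.rpow_one, sub_self, abs_zero]
    exact hε
  obtain ⟨δ₁, hδ₁, h1⟩ := Metric.eventually_nhds_iff.1 h1
  obtain ⟨δ₂, hδ₂, h2⟩ := Metric.eventually_nhds_iff.1 h2
  have hη : 0 < min δ₁ δ₂ / 2 := half_pos (lt_min hδ₁ hδ₂)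
  refine ⟨min δ₁ δ₂ / 2, hη, h1 ?_, fun u v hu hv => ?_⟩
  · rw [Real.dist_0_eq_abs, abs_of_pos hη]
    exact (half_lt_self (by linarith)).trans_le (min_le_left _ _)
  · rw [mul_div_cancel₀ _ two_ne_zero] at hu hv
    refine h2 (y := (u, v)) ?_
    rw [Prod.dist_eq, max_lt_iff]
    exact ⟨hu.trans_le (min_le_right _ _), hv.trans_le (min_le_right _ _)⟩

/-- The cone of points whose rescaled ratio of norms is within `ε` of `x`. -/
def ratioCone (n : ℕ) (p q x ε : ℝ) : Set (Fin n → ℝ) :=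
  {y | |(n : ℝ) ^ (1 / p - 1 / q) * (pnorm q y / pnorm p y) - x| < ε}

theorem measurableSet_ratioCone (n : ℕ) (p q x ε : ℝ) : MeasurableSet (ratioCone n p q x ε) :=
  measurableSet_lt (((measurable_pnorm.div measurable_pnorm).const_mul _).sub_const _).abs
    measurable_const

theorem smul_mem_ratioCone {n : ℕ} {x ε : ℝ} (hp : 0 < p) (hq : 0 < q) (r : ℝ) (hr : 0 < r)
    (y : Fin n → ℝ) : r • y ∈ ratioCone n p q x ε ↔ y ∈ ratioCone n p q x ε := by
  simp only [ratioCone, mem_ofPred_eq]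
  rw [pnorm_smul hq hr.le, pnorm_smul hp hr.le, mul_div_mul_left _ _ hr.ne']

theorem pi_pGaussian_ratioCone_le (hp : 0 < p) (hq : 0 < q) {x ε : ℝ} (hx : 0 < x) (hε : 0 < ε) :
    ∀ᶠ n : ℕ in atTop, (Measure.pi fun _ : Fin n => pGaussian p) (ratioCone n p q x ε) ≤
      2 * (nuMeasure n p).map (fun x => (n : ℝ) ^ (1 / p - 1 / q) * pnorm q x)
        (Ioo (x - 2 * ε) (x + 2 * ε)) := by
  have := isProbabilityMeasure_pGaussian hp
  set δ := min (1 / 2) (ε / x) with hδ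
  have hδ0 : 0 < δ := lt_min (by norm_num) (div_pos hε hx)
  have hδ1 : δ ≤ 1 / 2 := min_le_left _ _
  have hδx : x * δ ≤ ε := (mul_le_mul_of_nonneg_left (min_le_right _ _) hx.le).trans_eq
    (mul_div_cancel₀ _ hx.ne')
  have hlim : ∀ᶠ n : ℕ in atTop, (1 - δ) ^ n < 1 / 2 :=
    (tendsto_pow_atTop_nhds_zero_of_lt_one (by linarith) (by linarith)).eventually_lt_const
      (by norm_num)
  filter_upwards [hlim] with n hn
  have hm : Measurable fun x : Fin n → ℝ => (n : ℝ) ^ (1 / p - 1 / q) * pnorm q x :=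
    measurable_pnorm.const_mul _
  rw [Measure.map_apply hm measurableSet_Ioo]
  set W := (fun x : Fin n → ℝ => (n : ℝ) ^ (1 / p - 1 / q) * pnorm q x) ⁻¹'
    Ioo (x - 2 * ε) (x + 2 * ε) with hW
  set D := ratioCone n p q x ε with hD
  have hDm : MeasurableSet D := measurableSet_ratioCone n p q x ε
  have hcone := smul_mem_ratioCone (n := n) (x := x) (ε := ε) hp hq
  set B := {y : Fin n → ℝ | ∑ i, |y i| ^ p ≤ (1 - δ) ^ p} with hB
  have hsub : D ∩ pBall n p ⊆ D ∩ B ∪ W ∩ pBall n p := by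
    rintro y ⟨hyD, hyp⟩
    by_cases hyB : y ∈ B
    · exact Or.inl ⟨hyD, hyB⟩
    refine Or.inr ⟨?_, hyp⟩
    have h1 : pnorm p y ≤ 1 := hyp
    have h2 : 1 - δ < pnorm p y := by
      by_contra! h
      refine hyB ?_
      rw [hB, mem_ofPred_eq, ← pnorm_rpow hp]
      exact Real.rpow_le_rpow (pnorm_nonneg y) h hp.le
    have h0 : 0 < pnorm p y := by linarith
    have h3 : |(n : ℝ) ^ (1 / p - 1 / q) * (pnorm q y / pnorm p y) - x| < ε := hyD
    have h4 : (n : ℝ) ^ (1 / p - 1 / q) * pnorm q y =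
        (n : ℝ) ^ (1 / p - 1 / q) * (pnorm q y / pnorm p y) * pnorm p y := by
      field_simp
    rw [abs_lt] at h3
    simp only [hW, mem_preimage, mem_Ioo]
    rw [h4]
    constructor <;> nlinarith
  have hle : nuMeasure n p D ≤ nuMeasure n p (D ∩ B) + nuMeasure n p W := by
    have hBm : MeasurableSet B := measurableSet_le (by fun_prop) measurable_const
    refine le_trans ?_ (measure_union_le _ _)
    rw [nuMeasure_apply hDm, nuMeasure_apply ((hDm.inter hBm).union (hm measurableSet_Ioo))]
    have hsub' : D ∩ pBall n p ⊆ (D ∩ B ∪ W) ∩ pBall n p := fun y hy =>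
      ⟨(hsub hy).imp id fun h => h.1, hy.2⟩
    exact mul_le_mul_right (measure_mono hsub') _
  have hpow : ((1 - δ) ^ p) ^ ((n : ℝ) / p) = (1 - δ) ^ n := by
    rw [← Real.rpow_mul (by linarith), mul_div_cancel₀ _ hp.ne', Real.rpow_natCast]
  rw [nuMeasure_cone_inter_le hp hDm hcone (Real.rpow_pos_of_pos (by linarith) _)
    (Real.rpow_le_one (by linarith) (by linarith) hp.le), hpow, nuMeasure_cone hp hDm hcone] at hle
  have hfin : (Measure.pi fun _ : Fin n => pGaussian p) D ≠ ⊤ := measure_ne_top _ _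
  set a := (Measure.pi fun _ : Fin n => pGaussian p) D
  have hhalf : ENNReal.ofReal ((1 - δ) ^ n) * a ≤ a / 2 := by
    rw [ENNReal.div_eq_inv_mul]
    gcongr
    rw [← ENNReal.ofReal_ofNat 2, ← ENNReal.ofReal_inv_of_pos two_pos]
    exact ENNReal.ofReal_le_ofReal (by linarith)
  have h5 : a / 2 + a / 2 ≤ a / 2 + nuMeasure n p W :=
    (ENNReal.add_halves a).trans_le (hle.trans (by gcongr))
  have h6 := (ENNReal.add_le_add_iff_left (ENNReal.div_ne_top hfin two_ne_zero)).1 h5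
  rwa [ENNReal.div_le_iff two_ne_zero ENNReal.ofNat_ne_top, mul_comm] at h6

theorem pi_pGaussian_ratioCone_ge (hp : 0 < p) (hpq : p < q) {x c ε : ℝ} (hx : mpq p q ≤ x)
    (hc : 1 / p * (x ^ q - mpq p q ^ q) ^ (p / q) < c) (hε : 0 < ε) :
    ∃ d > 0, ∃ c₀ < c, ∀ᶠ n : ℕ in atTop,
      ENNReal.ofReal (d * Real.exp (-c₀ * (n : ℝ) ^ (p / q))) ≤
        (Measure.pi fun _ : Fin n => pGaussian p) (ratioCone n p q x ε) := by
  have hq : 0 < q := hp.trans hpq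
  have hr1 : p / q < 1 := (div_lt_one hq).2 hpq
  have := isProbabilityMeasure_pGaussian hp
  have hx0 : 0 < x := (mpq_pos hp hq).trans_le hx
  rw [mpq_rpow hp hq] at hc
  set M := Mp p q with hM
  have hM0 : 0 < M := Mp_pos hp hq.le
  set t := x ^ q - M with ht
  have ht0 : 0 ≤ t := by
    rw [ht, hM, ← mpq_rpow hp hq, sub_nonneg]
    exact Real.rpow_le_rpow (mpq_pos hp hq).le hx hq.le
  obtain ⟨η, hη, hηc, hwin⟩ := exists_window hp hq hx0 hc hε
  obtain ⟨d, hd, hwge⟩ := pGaussian_window_ge hp hq ht0 hη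
  refine ⟨d / 2, half_pos hd, _, hηc, ?_⟩
  rw [← Filter.map_add_atTop_eq_nat 1, eventually_map]
  have hdev : ∀ s : ℝ, 0 ≤ s → ∀ᶠ k : ℕ in atTop, (Measure.pi fun _ : Fin k => pGaussian p)
      {y | η / 2 * (k + 1 : ℕ) ≤ |∑ i, |y i| ^ s - k * Mp p s|} ≤ 4⁻¹ := fun s hs =>
    ((tendsto_pi_pGaussian_deviation hp hs (half_pos hη)).eventually_lt_const
      (by simp)).mono fun _ h => h.le
  have hcast : Tendsto (fun k : ℕ => ((k + 1 : ℕ) : ℝ)) atTop atTop :=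
    tendsto_natCast_atTop_atTop.comp (tendsto_add_atTop_nat 1)
  have hpow : ∀ᶠ k : ℕ in atTop, (t + η) ^ (p / q) ≤ η * ((k + 1 : ℕ) : ℝ) ^ (1 - p / q) :=
    (((tendsto_rpow_atTop (sub_pos.2 hr1)).const_mul_atTop hη).comp hcast).eventually_ge_atTop _
  filter_upwards [hdev q hq.le, hdev p hp.le, hpow,
    (hcast.const_mul_atTop (half_pos hη)).eventually_gt_atTop (max M 1)] with k h1 h2 h3 h4
  set n := k + 1 with hn
  have hn' : (0 : ℝ) < n := by positivity
  have hkn : (k : ℝ) = n - 1 := by rw [hn]; push_cast; ring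
  set A := {z : ℝ | n * t ≤ |z| ^ q ∧ |z| ^ q ≤ n * (t + η)} with hA
  set Fq := {y : Fin k → ℝ | η / 2 * n ≤ |∑ i, |y i| ^ q - k * Mp p q|} with hFq
  set Fp := {y : Fin k → ℝ | η / 2 * n ≤ |∑ i, |y i| ^ p - k * Mp p p|} with hFp
  set E := (Fq ∪ Fp)ᶜ with hE
  have hEm : MeasurableSet (Fq ∪ Fp) :=
    (measurableSet_le measurable_const (by fun_prop)).union
      (measurableSet_le measurable_const (by fun_prop))
  have hEge : (2 : ℝ≥0∞)⁻¹ ≤ (Measure.pi fun _ : Fin k => pGaussian p) E := by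
    rw [hE, prob_compl_eq_one_sub hEm]
    have h5 : (Measure.pi fun _ : Fin k => pGaussian p) (Fq ∪ Fp) ≤ 2⁻¹ := by
      refine (measure_union_le _ _).trans ((add_le_add h1 h2).trans_eq ?_)
      rw [← two_mul, show (4 : ℝ≥0∞) = 2 * 2 by norm_num,
        ENNReal.mul_inv (by simp) (by simp), ← mul_assoc,
        ENNReal.mul_inv_cancel two_ne_zero ENNReal.ofNat_ne_top, one_mul]
    refine le_trans (le_of_eq ?_) (tsub_le_tsub_left h5 1)
    exact ENNReal.one_sub_inv_two.symm
  have hsub : (MeasurableEquiv.piFinSuccAbove (fun _ => ℝ) 0) ⁻¹' (A ×ˢ E) ⊆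
      ratioCone n p q x ε := by
    rintro y ⟨⟨hy1, hy2⟩, hy3⟩
    simp only [hE, hFq, hFp, mem_compl_iff, mem_union, mem_ofPred_eq, not_or, not_le,
      Mp_self hp, mul_one] at hy3
    simp only [MeasurableEquiv.piFinSuccAbove_apply, Fin.insertNthEquiv_zero,
      Fin.consEquiv_symm_apply, Fin.tail_def] at hy1 hy2 hy3
    obtain ⟨hyq, hyp⟩ := hy3
    rw [hkn, abs_lt] at hyq hyp
    have hMn : M < η / 2 * n := (le_max_left _ _).trans_lt h4
    have h1n : 1 < η / 2 * n := (le_max_right _ _).trans_lt h4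
    have hy4 : |y 0| ^ p ≤ η * n := by
      have h6 := Real.rpow_le_rpow (by positivity) hy2 (div_nonneg hp.le hq.le)
      rw [← Real.rpow_mul (abs_nonneg _), mul_div_cancel₀ _ hq.ne',
        Real.mul_rpow hn'.le (by linarith)] at h6
      refine h6.trans ?_
      calc (n : ℝ) ^ (p / q) * (t + η) ^ (p / q)
          ≤ (n : ℝ) ^ (p / q) * (η * (n : ℝ) ^ (1 - p / q)) := by gcongr
        _ = η * n := by
          rw [mul_left_comm, ← Real.rpow_add hn', add_sub_cancel, Real.rpow_one]
    have hu : |(∑ i, |y i| ^ q) / n - x ^ q| < 2 * η := by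
      rw [div_sub' hn'.ne', abs_div, abs_of_pos hn', div_lt_iff₀ hn', Fin.sum_univ_succ, abs_lt]
      have hxq : x ^ q = M + t := by rw [ht]; ring
      rw [hxq]
      constructor <;> nlinarith [hyq.1, hyq.2]
    have hv : |(∑ i, |y i| ^ p) / n - 1| < 2 * η := by
      rw [div_sub' hn'.ne', abs_div, abs_of_pos hn', div_lt_iff₀ hn', Fin.sum_univ_succ, abs_lt]
      have : 0 ≤ |y 0| ^ p := by positivity
      constructor <;> nlinarith [hyp.1, hyp.2]
    have hw := (hwin _ _ hu hv).2
    change |(n : ℝ) ^ (1 / p - 1 / q) * ((∑ i, |y i| ^ q) ^ (1 / q) /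
      (∑ i, |y i| ^ p) ^ (1 / p)) - x| < ε
    rw [Real.div_rpow (Finset.sum_nonneg fun i _ => by positivity) hn'.le,
      Real.div_rpow (Finset.sum_nonneg fun i _ => by positivity) hn'.le] at hw
    convert hw using 3
    rw [Real.rpow_sub hn']
    field_simp
  refine le_trans ?_ (measure_mono hsub)
  have hmp := measurePreserving_piFinSuccAbove (fun _ : Fin (k + 1) => pGaussian p) 0
  rw [hmp.measure_preimage_equiv, Measure.prod_prod]
  refine le_trans ?_ (mul_le_mul' (hwge n k.succ_pos) hEge)
  rw [← ENNReal.ofReal_ofNat 2, ← ENNReal.ofReal_inv_of_pos two_pos,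
    ← ENNReal.ofReal_mul (by positivity)]
  exact ENNReal.ofReal_le_ofReal (le_of_eq (by ring))

theorem le_map_Ioo (hp : 0 < p) (hpq : p < q) {x c ε : ℝ} (hx : mpq p q ≤ x)
    (hc : 1 / p * (x ^ q - mpq p q ^ q) ^ (p / q) < c) (hε : 0 < ε) :
    ∀ᶠ n : ℕ in atTop, ENNReal.ofReal (Real.exp (-c * (n : ℝ) ^ (p / q))) ≤
      (nuMeasure n p).map (fun x => (n : ℝ) ^ (1 / p - 1 / q) * pnorm q x)
        (Ioo (x - ε) (x + ε)) := by
  have hq : 0 < q := hp.trans hpq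
  obtain ⟨d, hd, c₀, hc₀, hge⟩ := pi_pGaussian_ratioCone_ge hp hpq hx hc (half_pos hε)
  filter_upwards [hge, pi_pGaussian_ratioCone_le hp hq ((mpq_pos hp hq).trans_le hx) (half_pos hε),
    eventually_mul_exp_neg_rpow_le (div_pos hp hq) hc₀ 0 (2 / d)] with n h1 h2 h3
  rw [mul_div_cancel₀ _ two_ne_zero] at h2
  rw [zero_mul, zero_add] at h3
  have h4 : 2 * ENNReal.ofReal (Real.exp (-c * (n : ℝ) ^ (p / q))) ≤
      ENNReal.ofReal (d * Real.exp (-c₀ * (n : ℝ) ^ (p / q))) := by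
    rw [← ENNReal.ofReal_ofNat 2, ← ENNReal.ofReal_mul two_pos.le]
    refine ENNReal.ofReal_le_ofReal ?_
    calc 2 * Real.exp (-c * (n : ℝ) ^ (p / q))
        = d * (2 / d * Real.exp (-c * (n : ℝ) ^ (p / q))) := by field_simp
      _ ≤ _ := by gcongr
  exact (ENNReal.mul_le_mul_iff_right two_ne_zero ENNReal.ofNat_ne_top).1 (h4.trans (h1.trans h2))

end LowerBound

section LargeDeviations

theorem inv_mul_log_le {m : ℝ≥0∞} {s c : ℝ} (hs : 0 < s)
    (h : m ≤ ENNReal.ofReal (Real.exp (-c * s))) :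
    ((s⁻¹ : ℝ) : EReal) * ENNReal.log m ≤ ((-c : ℝ) : EReal) := by
  have h1 := ENNReal.log_monotone h
  rw [ENNReal.log_ofReal_of_pos (Real.exp_pos _), Real.log_exp] at h1
  refine (mul_le_mul_of_nonneg_left h1 (EReal.coe_nonneg.2 (inv_nonneg.2 hs.le))).trans_eq ?_
  rw [← EReal.coe_mul]
  congr 1
  field_simp

theorem le_inv_mul_log {m : ℝ≥0∞} {s c : ℝ} (hs : 0 < s)
    (h : ENNReal.ofReal (Real.exp (-c * s)) ≤ m) :
    ((-c : ℝ) : EReal) ≤ ((s⁻¹ : ℝ) : EReal) * ENNReal.log m := by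
  have h1 := ENNReal.log_monotone h
  rw [ENNReal.log_ofReal_of_pos (Real.exp_pos _), Real.log_exp] at h1
  refine le_of_eq_of_le ?_
    (mul_le_mul_of_nonneg_left h1 (EReal.coe_nonneg.2 (inv_nonneg.2 hs.le)))
  rw [← EReal.coe_mul]
  congr 1
  field_simp

variable {p q : ℝ}

theorem isCompact_rate_le (hp : 0 < p) (hq : 0 < q) (c : ℝ≥0) :
    IsCompact {x : ℝ | (if mpq p q ≤ x then
      ENNReal.ofReal (1 / p * (x ^ q - mpq p q ^ q) ^ (p / q)) else ⊤) ≤ (c : ℝ≥0∞)} := by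
  have hr : 0 < p / q := div_pos hp hq
  have hset : {x : ℝ | (if mpq p q ≤ x then
      ENNReal.ofReal (1 / p * (x ^ q - mpq p q ^ q) ^ (p / q)) else ⊤) ≤ (c : ℝ≥0∞)} =
      Ici (mpq p q) ∩ {x | 1 / p * (x ^ q - mpq p q ^ q) ^ (p / q) ≤ c} := by
    ext x
    by_cases hx : mpq p q ≤ x
    · simp [hx, ENNReal.ofReal_le_iff_le_toReal]
    · simp [hx]
  rw [hset]
  refine (isCompact_Icc (a := mpq p q)
    (b := (mpq p q ^ q + (p * c) ^ (q / p)) ^ (1 / q))).of_isClosed_subset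
    (isClosed_Ici.inter (isClosed_le ?_ continuous_const)) ?_
  · exact continuous_const.mul (((Real.continuous_rpow_const hq.le).sub
      continuous_const).rpow_const fun _ => Or.inr hr.le)
  · rintro x ⟨hx, hxc⟩
    have hm := mpq_pos hp hq
    have hx0 : 0 < x := hm.trans_le hx
    have hy : 0 ≤ x ^ q - mpq p q ^ q := sub_nonneg.2 (Real.rpow_le_rpow hm.le hx hq.le)
    rw [mem_ofPred_eq, one_div, inv_mul_le_iff₀ hp] at hxc
    have h1 := Real.rpow_le_rpow (by positivity) hxc (div_nonneg hq.le hp.le)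
    rw [← Real.rpow_mul hy, div_mul_div_cancel₀ hq.ne', div_self hp.ne', Real.rpow_one] at h1
    have h2 := Real.rpow_le_rpow (by positivity)
      (show x ^ q ≤ mpq p q ^ q + (p * c) ^ (q / p) by linarith) (one_div_nonneg.2 hq.le)
    rw [← Real.rpow_mul hx0.le, mul_one_div_cancel hq.ne', Real.rpow_one] at h2
    exact ⟨hx, h2⟩

theorem map_le_of_lt_rate (hp : 0 < p) (hpq : p < q) {A : Set ℝ} (hA : mpq p q ∉ closure A)
    {c : ℝ} (hc : ∀ x ∈ closure A, mpq p q ≤ x →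
      c < 1 / p * (x ^ q - mpq p q ^ q) ^ (p / q)) :
    ∀ᶠ n : ℕ in atTop, (nuMeasure n p).map
      (fun x => (n : ℝ) ^ (1 / p - 1 / q) * pnorm q x) A ≤
        2 * ENNReal.ofReal (Real.exp (-c * (n : ℝ) ^ (p / q))) := by
  obtain ⟨b, hb, hbA⟩ := exists_Ioc_subset_of_mem_nhds
    (isClosed_closure.isOpen_compl.mem_nhds hA) (exists_lt (mpq p q))
  have hlow : A ∩ Iio (mpq p q) ⊆ Iic b := by
    rintro x ⟨hxA, hx⟩
    by_contra! h
    exact hbA ⟨not_le.1 h, le_of_lt hx⟩ (subset_closure hxA)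
  have hhigh : ∀ᶠ n : ℕ in atTop, (nuMeasure n p).map
      (fun x => (n : ℝ) ^ (1 / p - 1 / q) * pnorm q x) (A ∩ Ici (mpq p q)) ≤
        ENNReal.ofReal (Real.exp (-c * (n : ℝ) ^ (p / q))) := by
    rcases (closure A ∩ Ici (mpq p q)).eq_empty_or_nonempty with hE | hne
    · have hA0 : A ∩ Ici (mpq p q) = ∅ :=
        subset_eq_empty (inter_subset_inter_left _ subset_closure) hE
      rw [hA0]
      simp
    · have hbdd : BddBelow (closure A ∩ Ici (mpq p q)) := ⟨mpq p q, fun x hx => hx.2⟩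
      have hmem := (isClosed_closure.inter isClosed_Ici).csInf_mem hne hbdd
      have hlt : mpq p q < sInf (closure A ∩ Ici (mpq p q)) :=
        lt_of_le_of_ne hmem.2 fun h => hA (h ▸ hmem.1)
      filter_upwards [map_Ici_le hp hpq hlt (hc _ hmem.1 hmem.2)] with n hn
      exact (measure_mono fun x hx => csInf_le hbdd ⟨subset_closure hx.1, hx.2⟩).trans hn
  filter_upwards [map_Iic_le hp hpq hb c, hhigh] with n h1 h2
  rw [← inter_union_compl A (Iio (mpq p q)), compl_Iio, two_mul]
  exact (measure_union_le _ _).trans (add_le_add ((measure_mono hlow).trans h1) h2)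

end LargeDeviations

/-- LDP for `n^{1/p−1/q} ‖X^{(n)}‖_q`, `X^{(n)} ~ ν_p^n`, in the case `1 ≤ p < q < ∞`:
speed `n^{p/q}` and good rate function `I(x) = (1/p)(x^q − m_{p,q}^q)^{p/q}` for
`x ≥ m_{p,q}` and `I(x) = +∞` otherwise. -/
theorem ldp_qnorm_uniform_lp_ball (p q : ℝ) (hp : 1 ≤ p) (hpq : p < q) :
    IsLDP
      (fun n => Measure.map (fun x => (n : ℝ) ^ (1 / p - 1 / q) * pnorm q x)
        (nuMeasure n p))
      (fun n => (n : ℝ) ^ (p / q))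
      (fun x => if mpq p q ≤ x then
          ENNReal.ofReal (1 / p * (x ^ q - mpq p q ^ q) ^ (p / q))
        else ⊤) := by
  have hp0 : 0 < p := by linarith
  have hq : 0 < q := hp0.trans hpq
  have hr : 0 < p / q := div_pos hp0 hq
  have hrate : ∀ x, mpq p q ≤ x → 0 ≤ 1 / p * (x ^ q - mpq p q ^ q) ^ (p / q) := fun x hx =>
    mul_nonneg (by positivity) (Real.rpow_nonneg
      (sub_nonneg.2 (Real.rpow_le_rpow (mpq_pos hp0 hq).le hx hq.le)) _)
  refine ⟨isCompact_rate_le hp0 hq, fun A hA => ⟨?_, ?_⟩⟩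
  · refine EReal.ge_of_forall_gt_iff_ge.1 fun z hz => ?_
    rw [EReal.lt_neg_comm, ← EReal.coe_neg] at hz
    have hz0 : 0 < -z := EReal.coe_pos.1 ((EReal.coe_ennreal_nonneg _).trans_lt hz)
    rw [← max_eq_left hz0.le, ← EReal.coe_ennreal_ofReal,
      EReal.coe_ennreal_lt_coe_ennreal_iff, iInf_lt_iff] at hz
    obtain ⟨x, hx⟩ := hz
    obtain ⟨hxA, hx⟩ := iInf_lt_iff.1 hx
    have hmx : mpq p q ≤ x := by
      by_contra h
      simp [h] at hx
    simp only [if_pos hmx] at hx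
    rw [ENNReal.ofReal_lt_ofReal_iff hz0] at hx
    obtain ⟨ε, hε, hball⟩ := Metric.isOpen_iff.1 isOpen_interior x hxA
    rw [Real.ball_eq_Ioo] at hball
    refine le_liminf_of_le (by isBoundedDefault) ?_
    filter_upwards [le_map_Ioo hp0 hpq hmx hx hε, eventually_gt_atTop 0] with n h1 hn
    rw [← neg_neg z]
    exact le_inv_mul_log (Real.rpow_pos_of_pos (Nat.cast_pos.2 hn) _)
      (h1.trans (measure_mono (hball.trans interior_subset)))
  · by_cases hm : mpq p q ∈ closure A
    · have hzero : ⨅ x ∈ closure A, (if mpq p q ≤ x then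
          ENNReal.ofReal (1 / p * (x ^ q - mpq p q ^ q) ^ (p / q)) else ⊤) = 0 := by
        refine le_antisymm ((iInf₂_le _ hm).trans ?_) zero_le
        simp [hr.ne']
      rw [hzero, EReal.coe_ennreal_zero, neg_zero]
      refine limsup_le_of_le (by isBoundedDefault) ?_
      filter_upwards [eventually_gt_atTop 0] with n hn
      rw [Measure.map_apply (measurable_pnorm.const_mul _) hA]
      have h1 := inv_mul_log_le (m := nuMeasure n p
        ((fun x => (n : ℝ) ^ (1 / p - 1 / q) * pnorm q x) ⁻¹' A)) (c := 0)
        (Real.rpow_pos_of_pos (Nat.cast_pos.2 hn) (p / q)) (by simpa using nuMeasure_le_one _)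
      simpa using h1
    · refine EReal.le_neg_of_le_neg (EReal.ge_of_forall_gt_iff_ge.1 fun c hc => ?_)
      obtain ⟨c', hc', hcJ⟩ := EReal.lt_iff_exists_real_btwn.1 hc
      rw [EReal.coe_lt_coe_iff] at hc'
      refine EReal.le_neg_of_le_neg (limsup_le_of_le (by isBoundedDefault) ?_)
      have hlt : ∀ x ∈ closure A, mpq p q ≤ x →
          c' < 1 / p * (x ^ q - mpq p q ^ q) ^ (p / q) := by
        intro x hxA hx
        have h1 := hcJ.trans_le (EReal.coe_ennreal_le_coe_ennreal_iff.2 (iInf₂_le x hxA))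
        simp only [if_pos hx] at h1
        rwa [EReal.coe_ennreal_ofReal, max_eq_left (hrate x hx),
          EReal.coe_lt_coe_iff] at h1
      filter_upwards [map_le_of_lt_rate hp0 hpq hm hlt, eventually_gt_atTop 0,
        eventually_mul_exp_neg_rpow_le hr hc' 0 2] with n h1 hn h2
      rw [← EReal.coe_neg]
      refine inv_mul_log_le (Real.rpow_pos_of_pos (Nat.cast_pos.2 hn) _) (h1.trans ?_)
      rw [← ENNReal.ofReal_ofNat 2, ← ENNReal.ofReal_mul two_pos.le]
      rw [zero_mul, zero_add] at h2
      exact ENNReal.ofReal_le_ofReal h2
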